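/- Let G=(X,Y;E) be a bipartite graph and C a longest cycle of G. Suppose that |X| = n, |Y| = m, and |V(C)| = 2t, where n ≥ m ≥ t. If m ≤ 2t, then e(G−C) + e(G−C, C) ≤ t(n−1−t) + m, i.e. the number of edges of G having at least one endpoint outside V(C) is at most t(n−1−t)+m. -/

import Mathlib

namespace BipCycle

variable {V : Type} {G : SimpleGraph V}

/-- A list is a path of `G` from `a` to `b`. -/
structure IsP (G : SimpleGraph V) (l : List V) (a b : V) : Prop where
  chain : l.IsChain G.Adj
  nodup : l.Nodup
  head : l.head? = some a
  last : l.getLast? = some b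

namespace IsP

variable {l l₁ l₂ : List V} {a b x y : V}

lemma ne_nil (h : IsP G l a b) : l ≠ [] := by
  rintro rfl; simpa using h.head

lemma length_pos (h : IsP G l a b) : 0 < l.length := List.length_pos_iff.2 h.ne_nil

lemma head_mem (h : IsP G l a b) : a ∈ l := List.mem_of_head? h.head

lemma last_mem (h : IsP G l a b) : b ∈ l := List.mem_of_getLast? h.last

lemma reverse (h : IsP G l a b) : IsP G l.reverse b a where
  chain := by
    rw [List.isChain_reverse]
    exact h.chain.imp fun _ _ hxy => hxy.symm
  nodup := List.nodup_reverse.2 h.nodup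
  head := by simpa using h.last
  last := by simpa using h.head

lemma append (h₁ : IsP G l₁ a x) (h₂ : IsP G l₂ y b) (hxy : G.Adj x y)
    (hd : ∀ v ∈ l₁, v ∉ l₂) : IsP G (l₁ ++ l₂) a b where
  chain := by
    rw [List.isChain_append]
    refine ⟨h₁.chain, h₂.chain, ?_⟩
    rw [h₁.last, h₂.head]
    rintro u hu v hv
    simp at hu hv
    subst hu hv
    exact hxy
  nodup := h₁.nodup.append h₂.nodup (fun v hv hv' => hd v hv hv')
  head := by rw [List.head?_append, h₁.head]; rfl
  last := by rw [List.getLast?_append, h₂.last]; rfl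

lemma singleton (a : V) : IsP G [a] a a := ⟨by simp, by simp, rfl, rfl⟩

lemma eq_of_length_one (h : IsP G l a b) (hl : l.length = 1) : a = b := by
  obtain ⟨x, rfl⟩ := List.length_eq_one_iff.1 hl
  have h1 := h.head
  have h2 := h.last
  simp at h1 h2
  rw [← h1, ← h2]

lemma head_eq (h : IsP G l a b) : l[0]'h.length_pos = a := by
  have := h.head
  rw [List.head?_eq_getElem?, List.getElem?_eq_getElem h.length_pos] at this
  simpa using this

lemma last_eq (h : IsP G l a b) : l[l.length - 1]'(Nat.sub_lt h.length_pos one_pos) = b := by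
  have := h.last
  rw [List.getLast?_eq_getElem?, List.getElem?_eq_getElem (Nat.sub_lt h.length_pos one_pos)] at this
  simpa using this

lemma adj (h : IsP G l a b) {i : ℕ} (hi : i + 1 < l.length) : G.Adj l[i] l[i + 1] :=
  List.isChain_iff_getElem.1 h.chain i hi

lemma take (h : IsP G l a b) {i : ℕ} (hi : i < l.length) : IsP G (l.take (i + 1)) a l[i] where
  chain := h.chain.take _
  nodup := h.nodup.sublist (List.take_sublist _ _)
  head := by rw [List.head?_take]; simp [h.head]
  last := by
    rw [List.getLast?_eq_getElem?, List.getElem?_eq_getElem (by simp; omega)]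
    simp [Nat.min_eq_left (by omega : i + 1 ≤ l.length)]

lemma drop (h : IsP G l a b) {i : ℕ} (hi : i < l.length) : IsP G (l.drop i) l[i] b where
  chain := h.chain.drop _
  nodup := h.nodup.sublist (List.drop_sublist _ _)
  head := by rw [List.head?_drop, List.getElem?_eq_getElem hi]
  last := by rw [List.getLast?_drop, if_neg (by omega), h.last]

lemma mem_take_drop (h : IsP G l a b) {i j : ℕ} (hij : i ≤ j) {v : V} (hv : v ∈ l.take i) :
    v ∉ l.drop j := fun hv' => List.disjoint_take_drop h.nodup hij hv hv'

lemma getElem_inj (h : IsP G l a b) {i j : ℕ} (hi : i < l.length) (hj : j < l.length)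
    (e : l[i] = l[j]) : i = j := (h.nodup.getElem_inj_iff).1 e

end IsP

lemma col_getElem {col : V → Bool} (bip : ∀ u v, G.Adj u v → col u ≠ col v) {l : List V} {a b : V}
    (h : IsP G l a b) : ∀ i (hi : i < l.length), col l[i] = (col a).xor (decide (i % 2 = 1)) := by
  intro i
  induction i with
  | zero => intro hi; rw [h.head_eq]; simp
  | succ i ih =>
    intro hi
    have h1 := ih (by omega)
    have h2 := bip _ _ (h.adj hi)
    rcases Nat.mod_two_eq_zero_or_one i with h3 | h3
    · have h4 : (i + 1) % 2 = 1 := by omega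
      rw [h4]; rw [h3] at h1
      revert h1 h2
      cases col l[i] <;> cases col l[i+1] <;> cases col a <;> simp
    · have h4 : (i + 1) % 2 = 0 := by omega
      rw [h4]; rw [h3] at h1
      revert h1 h2
      cases col l[i] <;> cases col l[i+1] <;> cases col a <;> simp

lemma odd_length {col : V → Bool} (bip : ∀ u v, G.Adj u v → col u ≠ col v) {l : List V} {a b : V}
    (h : IsP G l a b) : l.length % 2 = 1 ↔ col a = col b := by
  have h0 := h.length_pos
  have h1 := col_getElem bip h (l.length - 1) (by omega)
  rw [h.last_eq] at h1
  rcases Nat.mod_two_eq_zero_or_one l.length with h3 | h3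
  · have : (l.length - 1) % 2 = 1 := by omega
    rw [this] at h1; rw [h1, h3]; simp
  · have : (l.length - 1) % 2 = 0 := by omega
    rw [this] at h1; rw [h1, h3]; simp

/-- `c` enumerates cyclically a longest cycle, of length `2 * t`, of the bipartite graph `G`. -/
structure LC (G : SimpleGraph V) (col : V → Bool) (t : ℕ) (c : ℤ → V) : Prop where
  two_le : 2 ≤ t
  bip : ∀ u v, G.Adj u v → col u ≠ col v
  adj : ∀ i, G.Adj (c i) (c (i + 1))
  per : ∀ i, c (i + 2 * t) = c i
  inj : ∀ i j, c i = c j → (2 * t : ℤ) ∣ (i - j)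
  long : ∀ l a b, IsP G l a b → 3 ≤ l.length → G.Adj b a → l.length ≤ 2 * t

/-- The vertex lies outside the cycle `c`. -/
def Out (c : ℤ → V) (v : V) : Prop := ∀ i, v ≠ c i

/-- The segment of `n` vertices of the cycle starting at index `i`. -/
def arc (c : ℤ → V) (i : ℤ) (n : ℕ) : List V := (List.range n).map fun k : ℕ => c (i + k)

variable {col : V → Bool} {t : ℕ} {c : ℤ → V}

lemma mem_arc {i : ℤ} {n : ℕ} {v : V} : v ∈ arc c i n ↔ ∃ k : ℕ, k < n ∧ c (i + k) = v := by
  simp [arc]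

lemma length_arc (i : ℤ) (n : ℕ) : (arc c i n).length = n := by simp [arc]

lemma Out.notMem_arc {v : V} (h : Out c v) (i : ℤ) (n : ℕ) : v ∉ arc c i n := by
  rw [mem_arc]; rintro ⟨k, _, hk⟩; exact h _ hk.symm

namespace LC

variable (H : LC G col t c)
include H

lemma inj' {i j : ℤ} (h : c i = c j) (h1 : i ≤ j) (h2 : j < i + 2 * t) : i = j := by
  obtain ⟨k, hk⟩ := H.inj j i h.symm
  have : (0:ℤ) < 2 * t := by have := H.two_le; omega
  have h3 : 0 ≤ k := by
    by_contra hh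
    have : k ≤ -1 := by omega
    nlinarith
  have h4 : k < 1 := by
    by_contra hh
    nlinarith
  have : k = 0 := by omega
  subst this; omega

lemma isP_arc (i : ℤ) {n : ℕ} (h1 : 1 ≤ n) (h2 : n ≤ 2 * t) :
    IsP G (arc c i n) (c i) (c (i + n - 1)) where
  chain := by
    rw [List.isChain_iff_getElem]
    intro k hk
    simp only [arc, List.getElem_map, List.getElem_range]
    have := H.adj (i + k)
    push_cast
    rwa [← add_assoc]
  nodup := by
    refine List.Nodup.map_on ?_ List.nodup_range
    intro x hx y hy hxy
    simp at hx hy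
    rcases le_total x y with h | h
    · have := H.inj' hxy (by omega) (by omega); omega
    · have := H.inj' hxy.symm (by omega) (by omega); omega
  head := by
    obtain ⟨n, rfl⟩ : ∃ m, n = m + 1 := ⟨n - 1, by omega⟩
    rw [List.head?_eq_getElem?, List.getElem?_eq_getElem (by rw [length_arc]; omega)]
    simp [arc]
  last := by
    rw [List.getLast?_eq_getElem?, List.getElem?_eq_getElem (by rw [length_arc]; omega)]
    simp only [arc, List.getElem_map, List.getElem_range, List.length_map, List.length_range]
    congr 2
    omega

lemma arc_disj {i j : ℤ} {n m : ℕ} (h1 : i + n ≤ j) (h2 : j + m ≤ i + 2 * t) :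
    ∀ v ∈ arc c i n, v ∉ arc c j m := by
  intro v hv hv'
  rw [mem_arc] at hv hv'
  obtain ⟨k, hk, rfl⟩ := hv
  obtain ⟨k', hk', h⟩ := hv'
  have := H.inj' h.symm (by omega) (by omega)
  omega

/-- A path outside the cycle between two vertices attached at the same cycle vertex. -/
lemma cyc0 {l : List V} {a b : V} (h : IsP G l a b) (ho : ∀ v ∈ l, Out c v) {i : ℤ}
    (ha : G.Adj a (c i)) (hb : G.Adj b (c i)) (hl : 2 ≤ l.length) : l.length + 1 ≤ 2 * t := by
  have := H.long (l ++ [c i]) a (c i) (h.append (IsP.singleton _) hb (by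
    intro v hv hv'
    simp at hv'
    exact ho v hv i hv')) (by simp; omega) ha.symm
  simpa using this

lemma cyc1 {l : List V} {a b : V} (h : IsP G l a b) (ho : ∀ v ∈ l, Out c v) {i j : ℤ}
    (ha : G.Adj a (c i)) (hb : G.Adj b (c j)) (hij : i < j) (hji : j < i + 2 * t) :
    (l.length : ℤ) + 1 ≤ j - i := by
  have h0 := h.length_pos
  set n := (i + 2 * t - j + 1).toNat with hn
  have hn' : (n : ℤ) = i + 2 * t - j + 1 := by omega
  have h1 := H.isP_arc j (n := n) (by omega) (by omega)
  have e : j + n - 1 = i + 2 * t := by omega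
  rw [e, H.per] at h1
  have h2 := H.long _ _ _ (h.append h1 hb (fun v hv => (ho v hv).notMem_arc _ _))
    (by rw [List.length_append, length_arc]; omega) ha.symm
  rw [List.length_append, length_arc] at h2
  omega

/-- Two disjoint external paths (one of them a single vertex) used crosswise. -/
lemma cyc2 {l : List V} {a b y : V} (h : IsP G l a b) (ho : ∀ v ∈ l, Out c v) (hy : Out c y)
    (hyl : y ∉ l) {i j u v : ℤ} (ha : G.Adj a (c i)) (hb : G.Adj b (c j))
    (hu : G.Adj y (c u)) (hv : G.Adj y (c v))
    (h1 : i < u) (h2 : u ≤ j) (h3 : j < v) (h4 : v ≤ i + 2 * t) :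
    (l.length : ℤ) + 3 ≤ (u - i) + (v - j) := by
  set n := (j - u + 1).toNat with hn
  set m := (i + 2 * t - v + 1).toNat with hm
  have p1 := (H.isP_arc u (n := n) (by omega) (by omega)).reverse
  have e1 : u + n - 1 = j := by omega
  rw [e1] at p1
  have p2 := H.isP_arc v (n := m) (by omega) (by omega)
  have e2 : v + m - 1 = i + 2 * t := by omega
  rw [e2, H.per] at p2
  have p3 := h.append p1 hb (fun w hw => by
    rw [List.mem_reverse]; exact (ho w hw).notMem_arc _ _)
  have p4 := p3.append (IsP.singleton y) hu.symm (by
    intro w hw hw'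
    simp at hw'
    subst hw'
    rw [List.mem_append, List.mem_reverse] at hw
    exact hw.elim hyl (hy.notMem_arc _ _))
  have p5 := p4.append p2 hv (by
    intro w hw
    simp only [List.mem_append, List.mem_reverse, List.mem_singleton] at hw
    rcases hw with (hw | hw) | rfl
    · exact (ho w hw).notMem_arc _ _
    · exact H.arc_disj (by omega) (by omega) w hw
    · exact hy.notMem_arc _ _)
  have h0 := h.length_pos
  have p6 := H.long _ _ _ p5 (by simp [length_arc]; omega) ha.symm
  simp [length_arc] at p6
  omega

lemma col_c (i : ℤ) : ∀ n : ℕ, col (c (i + 2 * n)) = col (c i) := by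
  intro n
  induction n with
  | zero => simp
  | succ n ih =>
    have h1 := H.bip _ _ (H.adj (i + 2 * n))
    have h2 := H.bip _ _ (H.adj (i + 2 * n + 1))
    have e : i + 2 * n + 1 + 1 = i + 2 * (n + 1 : ℕ) := by push_cast; ring
    rw [e] at h2
    rw [← ih]
    revert h1 h2
    cases col (c (i + 2 * n)) <;> cases col (c (i + 2 * n + 1)) <;>
      cases col (c (i + 2 * (n + 1 : ℕ))) <;> simp

lemma col_c_odd (i : ℤ) (n : ℕ) : col (c (i + 2 * n + 1)) ≠ col (c i) := by
  rw [← H.col_c i n]; exact (H.bip _ _ (H.adj _)).symm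

lemma periodic_mul (i : ℤ) (k : ℤ) : c (i + 2 * t * k) = c i := by
  have : Function.Periodic c (2 * t) := fun x => H.per x
  have := this.int_mul k i
  rw [← this]; congr 1; simp; ring

end LC

section
open Finset
open scoped Classical

variable {V : Type} {G : SimpleGraph V} {col : V → Bool} {t : ℕ} {c : ℤ → V}

lemma card_four_le {N : ℕ} {A B C D : Finset ℕ}
    (hA : ∀ x ∈ A, x < N) (hB : ∀ x ∈ B, x < N)
    (hC : ∀ x ∈ C, x < N) (hD : ∀ x ∈ D, x < N) (hAB : ∀ x ∈ A, x ∉ B) (hAC : ∀ x ∈ A, x ∉ C)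
    (hAD : ∀ x ∈ A, x ∉ D) (hBC : ∀ x ∈ B, x ∉ C) (hBD : ∀ x ∈ B, x ∉ D) (hCD : ∀ x ∈ C, x ∉ D) :
    #A + #B + #C + #D ≤ N := by
  have h1 : #(A ∪ B ∪ C ∪ D) ≤ #(range N) := card_le_card (by
    intro x hx
    simp only [mem_union, mem_range] at hx ⊢
    rcases hx with ((hx | hx) | hx) | hx
    exacts [hA x hx, hB x hx, hC x hx, hD x hx])
  rw [card_union_of_disjoint, card_union_of_disjoint, card_union_of_disjoint, card_range] at h1
  · exact h1
  · exact disjoint_left.2 hAB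
  · rw [disjoint_left]; intro x hx; rw [mem_union] at hx
    exact hx.elim (hAC x) (hBC x)
  · rw [disjoint_left]; intro x hx; simp only [mem_union] at hx
    rcases hx with (hx | hx) | hx
    exacts [hAD x hx, hBD x hx, hCD x hx]

lemma num_opp {t κ : ℕ} {S T : Finset ℕ} (hS : ∀ p ∈ S, p < t) (hκ : 1 ≤ κ)
    (hT0 : T.Nonempty) (hT : ∀ q ∈ T, κ ≤ q ∧ q + κ + 1 ≤ t)
    (h1 : ∀ p ∈ S, ∀ q ∈ T, p ≤ q → p + κ ≤ q) (h2 : ∀ p ∈ S, ∀ q ∈ T, q < p → q + κ + 1 ≤ p) :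
    #S + #T + 2 * κ ≤ t + 1 := by
  have m1 := T.min'_mem hT0
  have m2 := T.max'_mem hT0
  have n1 := fun q hq => T.min'_le q hq
  have n2 := fun q hq => T.le_max' q hq
  set j := T.min' hT0
  set j' := T.max' hT0
  have := card_four_le (N := t) (A := S) (B := T) (C := Ico (j + 1 - κ) j) (D := Ioc j' (j' + κ))
    hS (fun q hq => by have := hT q hq; omega)
    (fun x hx => by have := hT j m1; simp at hx; omega)
    (fun x hx => by have := hT j' m2; simp at hx; omega)
    (fun x hx hx' => by have := h1 x hx x hx'; omega)
    (fun x hx hx' => by have := h1 x hx j m1; simp at hx'; omega)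
    (fun x hx hx' => by have := h2 x hx j' m2; simp at hx'; omega)
    (fun x hx hx' => by have := n1 x hx; simp at hx'; omega)
    (fun x hx hx' => by have := n2 x hx; simp at hx'; omega)
    (fun x hx hx' => by have := n1 j' m2; simp at hx hx'; omega)
  simp at this
  have := hT j m1
  omega

lemma num_same {t k : ℕ} {S T : Finset ℕ} (hS : ∀ p ∈ S, p < t) (hk : 2 ≤ k)
    (h0 : 0 ∈ S) (hT0 : ∃ q ∈ T, q ≠ 0) (hT : ∀ q ∈ T, q ≠ 0 → k ≤ q ∧ q + k ≤ t)
    (h1 : ∀ p ∈ S, ∀ q ∈ T, p < q → p + k ≤ q) (h2 : ∀ p ∈ S, ∀ q ∈ T, q < p → q + k ≤ p) :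
    #S + #T + 2 * k ≤ t + 4 := by
  have hT0' : (T.erase 0).Nonempty := by
    obtain ⟨q, hq, hq'⟩ := hT0; exact ⟨q, by simp [hq, hq']⟩
  have m1 := (T.erase 0).min'_mem hT0'
  have m2 := (T.erase 0).max'_mem hT0'
  have n1 := fun q hq => (T.erase 0).min'_le q hq
  have n2 := fun q hq => (T.erase 0).le_max' q hq
  set j := (T.erase 0).min' hT0'
  set j' := (T.erase 0).max' hT0'
  simp only [mem_erase] at m1 m2 n1 n2
  have b1 := hT j m1.2 m1.1
  have b2 := hT j' m2.2 m2.1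
  have n3 : ∀ q ∈ T, q = 0 ∨ (j ≤ q ∧ q ≤ j') := by
    intro q hq
    by_cases h : q = 0
    · exact Or.inl h
    · exact Or.inr ⟨n1 q ⟨h, hq⟩, n2 q ⟨h, hq⟩⟩
  have := card_four_le (N := t) (A := S) (B := T.image (· + 1)) (C := Ico (j + 2 - k) j)
    (D := Ioo (j' + 1) (j' + k))
    hS
    (fun x hx => by
      simp at hx; obtain ⟨q, hq, rfl⟩ := hx
      have := hT q hq
      have := n3 q hq
      omega)
    (fun x hx => by simp at hx; omega)
    (fun x hx => by simp at hx; omega)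
    (fun x hx hx' => by
      simp at hx'; obtain ⟨q, hq, rfl⟩ := hx'
      have := h2 _ hx q hq
      omega)
    (fun x hx hx' => by have := h1 x hx j m1.2; simp at hx'; omega)
    (fun x hx hx' => by have := h2 x hx j' m2.2; simp at hx'; omega)
    (fun x hx hx' => by
      simp at hx; obtain ⟨q, hq, rfl⟩ := hx
      have := n3 q hq; simp at hx'; omega)
    (fun x hx hx' => by
      simp at hx; obtain ⟨q, hq, rfl⟩ := hx
      have := n3 q hq; simp at hx'; omega)
    (fun x hx hx' => by have := n3 j' m2.2; simp at hx hx'; omega)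
  rw [card_image_of_injective _ (add_left_injective 1)] at this
  simp at this
  omega

lemma num_cross {t k : ℕ} {S T : Finset ℕ} (hT : ∀ p ∈ T, p < t) (hk : 1 ≤ k)
    (hS0 : S.Nonempty) (hS : ∀ q ∈ S, k ≤ q ∧ q + k ≤ t)
    (h1 : ∀ p ∈ S, ∀ u ∈ T, ∀ v ∈ T, u < p → p ≤ v → p + k ≤ u + v)
    (h2 : ∀ p ∈ S, ∀ q ∈ S, p ∈ T → q ∈ T → p = q) :
    #S + #T + k ≤ t + 1 := by
  by_cases hc : ∃ b ∈ T, b < k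
  · have hT0 : T.Nonempty := ⟨_, hc.choose_spec.1⟩
    have m1 := T.min'_mem hT0
    have n1 := fun q hq => T.min'_le q hq
    set b := T.min' hT0
    have hb : b < k := by
      obtain ⟨x, hx, hx'⟩ := hc; have := n1 x hx; omega
    have m2 := S.max'_mem hS0
    have n2 := fun q hq => S.le_max' q hq
    set j := S.max' hS0
    have key : ∀ p ∈ S, ∀ v ∈ T, p ≤ v → p + k ≤ b + v := by
      intro p hp v hv hpv
      exact h1 p hp b m1 v hv (by have := hS p hp; omega) hpv
    have := card_four_le (N := t) (A := S) (B := T) (C := range b) (D := Ioo j (j + (k - b)))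
      (fun x hx => by have := hS x hx; omega) hT
      (fun x hx => by have := hT b m1; simp at hx; omega)
      (fun x hx => by have := hS j m2; simp at hx; omega)
      (fun x hx hx' => by have := key x hx x hx'; omega)
      (fun x hx hx' => by have := hS x hx; simp at hx'; omega)
      (fun x hx hx' => by have := n2 x hx; simp at hx'; omega)
      (fun x hx hx' => by have := n1 x hx; simp at hx'; omega)
      (fun x hx hx' => by have := key j m2 x hx; simp at hx'; omega)
      (fun x hx hx' => by have := hS j m2; simp at hx hx'; omega)
    simp at this
    omega
  · push Not at hc
    have e : #(S ∩ T) ≤ 1 := by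
      rw [card_le_one]
      intro p hp q hq
      simp at hp hq
      exact h2 p hp.1 q hq.1 hp.2 hq.2
    have e2 := card_sdiff_add_card_inter S T
    have := card_four_le (N := t) (A := S \ T) (B := T) (C := range k) (D := ∅)
      (fun x hx => by simp at hx; have := hS x hx.1; omega) hT
      (fun x hx => by have := hS _ hS0.choose_spec; simp at hx; omega)
      (fun x hx => by simp at hx)
      (fun x hx hx' => by simp at hx; exact hx.2 hx')
      (fun x hx hx' => by simp at hx hx'; have := hS x hx.1; omega)
      (fun x hx hx' => by simp at hx')
      (fun x hx hx' => by have := hc x hx; simp at hx'; omega)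
      (fun x hx hx' => by simp at hx')
      (fun x hx hx' => by simp at hx')
    simp at this
    omega

/-- Slots are numbered `0, …, t - 1`. -/
lemma num_single {t p r : ℕ} {T : Finset ℕ} (hT : ∀ x ∈ T, x < t) (hp : r ≤ p + 1) (hpr : p + r ≤ t)
    (h1 : ∀ u ∈ T, ∀ v ∈ T, u < p → p ≤ v → p + r ≤ u + v + 1) :
    #T + r ≤ t + 1 := by
  by_cases hc : ∃ b ∈ T, b + 1 < r
  · have hT0 : T.Nonempty := ⟨_, hc.choose_spec.1⟩
    have m1 := T.min'_mem hT0
    have n1 := fun q hq => T.min'_le q hq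
    set b := T.min' hT0
    have hb : b + 1 < r := by
      obtain ⟨x, hx, hx'⟩ := hc; have := n1 x hx; omega
    have key : ∀ v ∈ T, p ≤ v → p + r ≤ b + v + 1 := by
      intro v hv hpv
      exact h1 b m1 v hv (by omega) hpv
    have := card_four_le (N := t) (A := ∅) (B := T) (C := range b) (D := Ico p (p + (r - b - 1)))
      (fun x hx => by simp at hx) hT
      (fun x hx => by have := hT b m1; simp at hx; omega)
      (fun x hx => by simp at hx; omega)
      (fun x hx hx' => by simp at hx)
      (fun x hx hx' => by simp at hx)
      (fun x hx hx' => by simp at hx)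
      (fun x hx hx' => by have := n1 x hx; simp at hx'; omega)
      (fun x hx hx' => by have := key x hx; simp at hx'; omega)
      (fun x hx hx' => by simp at hx hx'; omega)
    simp at this
    omega
  · push Not at hc
    have := card_four_le (N := t) (A := ∅) (B := T) (C := range (r - 1)) (D := ∅)
      (fun x hx => by simp at hx) hT
      (fun x hx => by simp at hx; omega)
      (fun x hx => by simp at hx)
      (fun x hx hx' => by simp at hx)
      (fun x hx hx' => by simp at hx)
      (fun x hx hx' => by simp at hx')
      (fun x hx hx' => by have := hc x hx; simp at hx'; omega)
      (fun x hx hx' => by simp at hx')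
      (fun x hx hx' => by simp at hx')
    simp at this
    omega

/-- Indices `p < t` such that `w` is adjacent to the cycle vertex `c (j + 2 * p)`. -/
noncomputable def slots (G : SimpleGraph V) (c : ℤ → V) (t : ℕ) (j : ℤ) (w : V) : Finset ℕ :=
  {p ∈ range t | G.Adj w (c (j + 2 * p))}

lemma mem_slots {j : ℤ} {w : V} {p : ℕ} :
    p ∈ slots G c t j w ↔ p < t ∧ G.Adj w (c (j + 2 * p)) := by simp [slots]

/-- The number of neighbours on the cycle. -/
noncomputable def dC [Fintype V] (G : SimpleGraph V) (c : ℤ → V) (w : V) : ℕ :=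
  #{v : V | G.Adj w v ∧ ¬ Out c v}

/-- There is a path outside the cycle with at least `n` vertices from `a` to `b`. -/
def Conn (G : SimpleGraph V) (c : ℤ → V) (a b : V) (n : ℕ) : Prop :=
  ∃ l, IsP G l a b ∧ (∀ v ∈ l, Out c v) ∧ n ≤ l.length

lemma Conn.symm {a b : V} {n : ℕ} (h : Conn G c a b n) : Conn G c b a n := by
  obtain ⟨l, h1, h2, h3⟩ := h
  exact ⟨l.reverse, h1.reverse, by simpa using h2, by simpa using h3⟩

lemma Conn.mono {a b : V} {n m : ℕ} (h : Conn G c a b n) (hm : m ≤ n) : Conn G c a b m := by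
  obtain ⟨l, h1, h2, h3⟩ := h
  exact ⟨l, h1, h2, hm.trans h3⟩

namespace LC

variable (H : LC G col t c)
include H

lemma exists_idx {i j : ℤ} (h : col (c i) = col (c j)) : ∃ p : ℕ, p < t ∧ c i = c (j + 2 * p) := by
  have ht := H.two_le
  have h0 : (0:ℤ) < 2 * t := by omega
  set r := (i - j) % (2 * t) with hr
  have r0 : 0 ≤ r := Int.emod_nonneg _ (by omega)
  have r1 : r < 2 * t := Int.emod_lt_of_pos _ h0
  have e : c i = c (j + r) := by
    rw [← H.periodic_mul (j + r) ((i - j) / (2 * t))]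
    congr 1
    have := Int.emod_add_mul_ediv (i - j) (2 * t)
    rw [← hr] at this
    linarith
  obtain ⟨n, hn⟩ : ∃ n : ℕ, r = n := ⟨r.toNat, by omega⟩
  rcases Nat.mod_two_eq_zero_or_one n with h3 | h3
  · refine ⟨n / 2, by omega, ?_⟩
    rw [e]; congr 2; omega
  · exfalso
    have := H.col_c_odd j (n / 2)
    apply this
    rw [← h, e]; congr 2; omega

lemma bip_eq {w : V} {i j : ℤ} (hw : G.Adj w (c i)) (hc : col w ≠ col (c j)) :
    col (c i) = col (c j) := by
  have := H.bip _ _ hw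
  revert this hc
  cases col w <;> cases col (c i) <;> cases col (c j) <;> simp

lemma exists_slot {w : V} {i j : ℤ} (hw : G.Adj w (c i)) (hc : col w ≠ col (c j)) :
    ∃ p ∈ slots G c t j w, c i = c (j + 2 * p) := by
  obtain ⟨p, hp, e⟩ := H.exists_idx (H.bip_eq hw hc)
  exact ⟨p, mem_slots.2 ⟨hp, e ▸ hw⟩, e⟩

lemma col_c_ne (j : ℤ) : col (c j) ≠ col (c (j + 1)) := H.bip _ _ (H.adj j)

lemma dC_eq [Fintype V] {w : V} {j : ℤ} (hc : col w ≠ col (c j)) : dC G c w = #(slots G c t j w) := by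
  symm
  refine card_bij (fun p _ => c (j + 2 * p)) ?_ ?_ ?_
  · intro p hp
    rw [mem_slots] at hp
    simp only [mem_filter, mem_univ, true_and]
    exact ⟨hp.2, fun h => h _ rfl⟩
  · intro p hp q hq e
    rw [mem_slots] at hp hq
    rcases le_total p q with h | h
    · have := H.inj' e (by omega) (by omega); omega
    · have := H.inj' e.symm (by omega) (by omega); omega
  · intro v hv
    simp only [mem_filter, mem_univ, true_and, Out, not_forall, not_not] at hv
    obtain ⟨hv, i, rfl⟩ := hv
    obtain ⟨p, hp, e⟩ := H.exists_slot hv hc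
    exact ⟨p, hp, e.symm⟩

lemma exists_adj [Fintype V] {w : V} (h : 1 ≤ dC G c w) : ∃ i, G.Adj w (c i) := by
  obtain ⟨v, hv⟩ := card_pos.1 h
  simp only [mem_filter, mem_univ, true_and, Out, not_forall, not_not] at hv
  obtain ⟨hv, i, rfl⟩ := hv
  exact ⟨i, hv⟩

lemma dC_pos [Fintype V] {w : V} {i : ℤ} (h : G.Adj w (c i)) : 1 ≤ dC G c w :=
  card_pos.2 ⟨c i, by
    simp only [mem_filter, mem_univ, true_and]
    exact ⟨h, fun h => h _ rfl⟩⟩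

lemma exists_adj_ne [Fintype V] {w x : V} (h : 2 ≤ dC G c w) : ∃ i, G.Adj w (c i) ∧ c i ≠ x := by
  obtain ⟨v, hv, hvx⟩ := Finset.exists_mem_ne (Nat.lt_of_succ_le h) x
  simp only [mem_filter, mem_univ, true_and, Out, not_forall, not_not] at hv
  obtain ⟨hv, i, rfl⟩ := hv
  exact ⟨i, hv, hvx⟩

lemma dC_le [Fintype V] (w : V) : dC G c w ≤ t := by
  by_cases h : 1 ≤ dC G c w
  · obtain ⟨i, hi⟩ := H.exists_adj h
    rw [H.dC_eq (H.bip _ _ hi)]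
    exact (card_filter_le _ _).trans (by simp)
  · omega

lemma conn_gap {a b : V} {n : ℕ} (h : Conn G c a b n) {i j : ℤ} (ha : G.Adj a (c i))
    (hb : G.Adj b (c j)) (hne : c i ≠ c j) (hij : i ≤ j) (hji : j ≤ i + 2 * t) :
    (n : ℤ) + 1 ≤ j - i ∧ (n : ℤ) + 1 ≤ i + 2 * t - j := by
  have h1 : i ≠ j := fun e => hne (by rw [e])
  have h2 : j ≠ i + 2 * t := fun e => hne (by rw [e, H.per])
  obtain ⟨l, hl, ho, hn⟩ := h
  have := H.cyc1 hl ho ha hb (by omega) (by omega)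
  have := H.cyc1 hl.reverse (by simpa using ho) hb (by rwa [H.per] : G.Adj a (c (i + 2 * t)))
    (by omega) (by omega)
  rw [List.length_reverse] at this
  omega

lemma ne_of_lt {i j : ℤ} (h1 : i < j) (h2 : j < i + 2 * t) : c i ≠ c j := fun e => by
  have := H.inj' e h1.le h2; omega

lemma gap_two {a b : V} {n : ℕ} (h : Conn G c a b n) {i j : ℤ} (ha : G.Adj a (c i))
    (hb : G.Adj b (c j)) (hne : c i ≠ c j) : n + 1 ≤ t := by
  have ht := H.two_le
  have h0 : (0:ℤ) < 2 * t := by omega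
  set r := (j - i) % (2 * t) with hr
  have r0 : 0 ≤ r := Int.emod_nonneg _ (by omega)
  have r1 : r < 2 * t := Int.emod_lt_of_pos _ h0
  have e : c j = c (i + r) := by
    rw [← H.periodic_mul (i + r) ((j - i) / (2 * t))]
    congr 1
    have := Int.emod_add_mul_ediv (j - i) (2 * t)
    rw [← hr] at this
    linarith
  rw [e] at hb hne
  have := H.conn_gap h ha hb hne (by omega) (by omega)
  omega

lemma even_length {a b : V} {n : ℕ} (h : Conn G c a b n) (hn : 1 ≤ n) (hc : col a ≠ col b) :
    ∃ κ, 1 ≤ κ ∧ n ≤ 2 * κ ∧ Conn G c a b (2 * κ) := by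
  obtain ⟨l, hl, ho, hn'⟩ := h
  have := odd_length H.bip hl
  simp only [hc, iff_false] at this
  exact ⟨l.length / 2, by omega, by omega, l, hl, ho, by omega⟩

lemma gap_opp [Fintype V] {a b : V} {n : ℕ} (h : Conn G c a b n) (hn : 1 ≤ n) (hc : col a ≠ col b)
    (ha : 1 ≤ dC G c a) (hb : 1 ≤ dC G c b) : dC G c a + dC G c b + n ≤ t + 1 := by
  obtain ⟨κ, hκ, hnκ, h⟩ := H.even_length h hn hc
  obtain ⟨j, hj⟩ := H.exists_adj ha
  have ca := H.bip _ _ hj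
  have cb : col b ≠ col (c (j + 1)) := by
    have := H.col_c_ne j
    revert this ca hc
    cases col a <;> cases col b <;> cases col (c j) <;> cases col (c (j + 1)) <;> simp
  have hdb := H.dC_eq cb
  rw [H.dC_eq ca, hdb]
  have := H.two_le
  have := num_opp (t := t) (κ := κ) (S := slots G c t j a) (T := slots G c t (j + 1) b)
    (fun p hp => (mem_slots.1 hp).1) hκ (card_pos.1 (by omega))
    (by
      intro q hq
      rw [mem_slots] at hq
      have := H.conn_gap h hj hq.2 (H.ne_of_lt (by omega) (by omega)) (by omega) (by omega)
      omega)
    (by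
      intro p hp q hq hpq
      rw [mem_slots] at hq hp
      have := H.conn_gap h hp.2 hq.2 (H.ne_of_lt (by omega) (by omega)) (by omega) (by omega)
      omega)
    (by
      intro p hp q hq hpq
      rw [mem_slots] at hq hp
      have := H.conn_gap h.symm hq.2 hp.2 (H.ne_of_lt (by omega) (by omega)) (by omega) (by omega)
      omega)
  omega

lemma gap_same [Fintype V] {a b : V} {k : ℕ} (h : Conn G c a b (2 * k - 1)) (hk : 2 ≤ k)
    (hc : col a = col b) {i j : ℤ} (ha : G.Adj a (c j)) (hb : G.Adj b (c i)) (hne : c i ≠ c j) :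
    dC G c a + dC G c b + 2 * k ≤ t + 4 := by
  have ca := H.bip _ _ ha
  have cb : col b ≠ col (c j) := hc ▸ ca
  rw [H.dC_eq ca, H.dC_eq cb]
  have := H.two_le
  refine num_same (t := t) (k := k) (S := slots G c t j a) (T := slots G c t j b)
    (fun p hp => (mem_slots.1 hp).1) hk (mem_slots.2 ⟨by omega, by simpa using ha⟩) ?_ ?_ ?_ ?_
  · obtain ⟨q, hq, e⟩ := H.exists_slot hb cb
    exact ⟨q, hq, by rintro rfl; simp at e; exact hne e⟩
  · intro q hq hq0
    rw [mem_slots] at hq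
    have := H.conn_gap h ha hq.2 (H.ne_of_lt (by omega) (by omega)) (by omega) (by omega)
    omega
  · intro p hp q hq hpq
    rw [mem_slots] at hq hp
    have := H.conn_gap h hp.2 hq.2 (H.ne_of_lt (by omega) (by omega)) (by omega) (by omega)
    omega
  · intro p hp q hq hpq
    rw [mem_slots] at hq hp
    have := H.conn_gap h.symm hq.2 hp.2 (H.ne_of_lt (by omega) (by omega)) (by omega) (by omega)
    omega

lemma gap_one_side [Fintype V] {a b : V} {k : ℕ} (h : Conn G c a b (2 * k - 1)) (hk : 1 ≤ k)
    (hc : col a = col b) (hb : 1 ≤ dC G c b) : dC G c a ≤ 1 ∨ dC G c a + 2 * k ≤ t + 2 := by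
  obtain ⟨j, hj⟩ := H.exists_adj hb
  have cb := H.bip _ _ hj
  have ca : col a ≠ col (c j) := hc ▸ cb
  rw [H.dC_eq ca]
  have key : ∀ p ∈ (slots G c t j a).erase 0, k ≤ p ∧ p + k ≤ t := by
    intro p hp
    rw [mem_erase, mem_slots] at hp
    have := H.conn_gap h.symm hj hp.2.2 (H.ne_of_lt (by omega) (by omega)) (by omega) (by omega)
    omega
  have h1 : #((slots G c t j a).erase 0) ≤ #(Icc k (t - k)) := by
    refine card_le_card fun p hp => ?_
    have := key p hp
    simp; omega
  have h2 := pred_card_le_card_erase (s := slots G c t j a) (a := 0)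
  simp at h1
  by_cases h3 : ((slots G c t j a).erase 0).Nonempty
  · have := key _ h3.choose_spec
    omega
  · rw [not_nonempty_iff_eq_empty] at h3
    rw [h3] at h2
    simp at h2; omega

lemma gap_three [Fintype V] {a b y : V} {k : ℕ} (hk : 2 ≤ k) (h1 : Conn G c y a (2 * k - 2))
    (h2 : Conn G c y b (2 * k - 2)) (h3 : Conn G c a b (2 * k - 1)) (hc : col a = col b)
    (hy : col y ≠ col a) (hyC : 1 ≤ dC G c y) (haC : 1 ≤ dC G c a) :
    dC G c a + dC G c b + 2 * k ≤ t + 3 := by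
  obtain ⟨j, hj⟩ := H.exists_adj hyC
  have cy := H.bip _ _ hj
  have ca : col a ≠ col (c (j + 1)) := by
    have := H.col_c_ne j
    revert this cy hy
    cases col a <;> cases col y <;> cases col (c j) <;> cases col (c (j + 1)) <;> simp
  have cb : col b ≠ col (c (j + 1)) := hc ▸ ca
  have hda := H.dC_eq ca
  rw [hda, H.dC_eq cb]
  have g1 : ∀ x, Conn G c y x (2 * k - 2) → ∀ p ∈ slots G c t (j + 1) x, k ≤ p + 1 ∧ p + k ≤ t := by
    intro x hx p hp
    rw [mem_slots] at hp
    have := H.conn_gap hx hj hp.2 (H.ne_of_lt (by omega) (by omega)) (by omega) (by omega)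
    omega
  have e : #(slots G c t (j + 1) a ∪ (slots G c t (j + 1) b).image (· + 1)) ≤
      #(Icc (k - 1) (t + 1 - k)) := by
    refine card_le_card fun p hp => ?_
    simp only [mem_union, mem_image, mem_Icc] at hp ⊢
    rcases hp with hp | ⟨p, hp, rfl⟩
    · have := g1 a h1 p hp
      omega
    · have := g1 b h2 p hp
      omega
  rw [card_union_of_disjoint, card_image_of_injective _ (add_left_injective 1)] at e
  · simp at e
    obtain ⟨p, hp⟩ := card_pos.1 (hda ▸ haC : 0 < #(slots G c t (j + 1) a))
    have := g1 a h1 p hp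
    omega
  · rw [disjoint_left]
    intro p hp hp'
    simp only [mem_image] at hp'
    obtain ⟨q, hq, rfl⟩ := hp'
    rw [mem_slots] at hp hq
    have := H.conn_gap h3.symm hq.2 hp.2 (H.ne_of_lt (by push_cast; omega) (by push_cast; omega))
      (by push_cast; omega) (by push_cast; omega)
    push_cast at this
    omega

/-- A path between two vertices of one colour and a further vertex of the other colour. -/
lemma gap_cross [Fintype V] {a b y : V} {k : ℕ} {l : List V} (hl : IsP G l a b)
    (ho : ∀ v ∈ l, Out c v) (hlen : 2 * k - 1 ≤ l.length) (hk : 1 ≤ k) (hy : Out c y) (hyl : y ∉ l)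
    (hc : col a = col b) (hya : col y ≠ col a) {i j : ℤ} (ha : G.Adj a (c i)) (hb : G.Adj b (c j))
    (hne : c i ≠ c j) : dC G c a + k + dC G c y ≤ t + 2 := by
  have cb := H.bip _ _ hb
  have ca : col a ≠ col (c j) := hc ▸ cb
  have cy : col y ≠ col (c (j + 1)) := by
    have := H.col_c_ne j
    revert this ca hya
    cases col a <;> cases col y <;> cases col (c j) <;> cases col (c (j + 1)) <;> simp
  have hda := H.dC_eq ca
  rw [hda, H.dC_eq cy]
  have hconn : Conn G c b a (2 * k - 1) := Conn.symm ⟨l, hl, ho, hlen⟩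
  have := H.two_le
  have := num_cross (t := t) (k := k) (S := (slots G c t j a).erase 0) (T := slots G c t (j + 1) y)
    (fun p hp => (mem_slots.1 hp).1) hk (by
      obtain ⟨q, hq, e⟩ := H.exists_slot ha ca
      exact ⟨q, mem_erase.2 ⟨by rintro rfl; simp at e; exact hne e, hq⟩⟩) (by
      intro p hp
      rw [mem_erase, mem_slots] at hp
      have := H.conn_gap hconn hb hp.2.2 (H.ne_of_lt (by omega) (by omega)) (by omega) (by omega)
      omega) (by
      intro p hp u hu v hv hup hpv
      rw [mem_erase] at hp
      rw [mem_slots] at hp hu hv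
      have := H.cyc2 hl.reverse (by simpa using ho) hy (by simpa using hyl) hb hp.2.2 hu.2 hv.2
        (by omega) (by omega) (by omega) (by omega)
      rw [List.length_reverse] at this
      omega) (by
      intro p hp q hq hpy hqy
      rw [mem_erase] at hp hq
      rw [mem_slots] at hp hq hpy hqy
      have hoa : Out c a := ho a hl.head_mem
      have main : ∀ p q : ℕ, p < t → q < t → G.Adj a (c (j + 2 * p)) → G.Adj a (c (j + 2 * q)) →
          G.Adj y (c (j + 1 + 2 * p)) → G.Adj y (c (j + 1 + 2 * q)) → p < q → False := by
        intro p q _ _ h1 h2 h3 h4 hpq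
        have := H.cyc2 (IsP.singleton a) (by simpa using hoa) hy
          (by simp; rintro rfl; exact hya rfl) h1 h2 h3 h4
          (by omega) (by omega) (by omega) (by omega)
        rw [List.length_singleton] at this
        push_cast at this
        omega
      rcases lt_trichotomy p q with h | h | h
      · exact (main p q hp.2.1 hq.2.1 hp.2.2 hq.2.2 hpy.2 hqy.2 h).elim
      · exact h
      · exact (main q p hq.2.1 hp.2.1 hq.2.2 hp.2.2 hqy.2 hpy.2 h).elim)
  have := pred_card_le_card_erase (s := slots G c t j a) (a := 0)
  omega

lemma dC_add_le [Fintype V] {x y : V} (hx : Out c x) (hy : Out c y) (hc : col y ≠ col x) :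
    dC G c x + dC G c y ≤ t + 1 := by
  by_cases h : 2 ≤ dC G c x
  · obtain ⟨j, hj⟩ := H.exists_adj (by omega : 1 ≤ dC G c x)
    obtain ⟨i, hi, hne⟩ := H.exists_adj_ne (x := c j) h
    have := H.gap_cross (k := 1) (IsP.singleton x) (by simpa using hx) (by simp) le_rfl hy
      (by simp; rintro rfl; exact hc rfl) rfl hc hi hj hne
    omega
  · have := H.dC_le y
    omega

/-- A path between two vertices of one colour and a further vertex of the same colour. -/
lemma gap_cross_same [Fintype V] {a b y : V} {k : ℕ} {l : List V} (hl : IsP G l a b)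
    (ho : ∀ v ∈ l, Out c v) (hlen : 2 * k - 1 ≤ l.length) (hk : 1 ≤ k) (hy : Out c y) (hyl : y ∉ l)
    (hc : col a = col b) (hya : col y = col a) {i j : ℤ} (ha : G.Adj a (c i)) (hb : G.Adj b (c j))
    (hne : c i ≠ c j) : dC G c y + k ≤ t + 1 := by
  have cb := H.bip _ _ hb
  have ca : col a ≠ col (c j) := hc ▸ cb
  have cy : col y ≠ col (c (j + 2)) := by
    have := H.col_c j 1
    simp at this
    rw [this, hya]; exact ca
  rw [H.dC_eq cy]
  have hconn : Conn G c b a (2 * k - 1) := Conn.symm ⟨l, hl, ho, hlen⟩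
  have := H.two_le
  obtain ⟨p, hp, e⟩ := H.exists_slot ha ca
  have hp0 : p ≠ 0 := by rintro rfl; simp at e; exact hne e
  rw [mem_slots] at hp
  have := H.conn_gap hconn hb hp.2 (H.ne_of_lt (by omega) (by omega)) (by omega) (by omega)
  refine num_single (p := p) (fun p hp => (mem_slots.1 hp).1) (by omega) (by omega) ?_
  intro u hu v hv hup hpv
  rw [mem_slots] at hu hv
  have := H.cyc2 hl.reverse (by simpa using ho) hy (by simpa using hyl) hb hp.2 hu.2 hv.2
    (by omega) (by omega) (by omega) (by omega)
  rw [List.length_reverse] at this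
  omega

/-- A path between two vertices of different colours and a further vertex. -/
lemma gap_cross_opp [Fintype V] {a b y : V} {k : ℕ} {l : List V} (hl : IsP G l a b)
    (ho : ∀ v ∈ l, Out c v) (hlen : 2 * k ≤ l.length) (hy : Out c y) (hyl : y ∉ l)
    (hya : col y ≠ col a) (hyb : col y = col b) (ha : 1 ≤ dC G c a) (hb : 1 ≤ dC G c b) :
    dC G c y + k ≤ t := by
  obtain ⟨j, hb⟩ := H.exists_adj hb
  obtain ⟨i, ha⟩ := H.exists_adj ha
  have cb := H.bip _ _ hb
  have ca : col a ≠ col (c (j + 1)) := by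
    have := H.col_c_ne j
    rw [hyb] at hya
    revert this cb hya
    cases col a <;> cases col b <;> cases col (c j) <;> cases col (c (j + 1)) <;> simp
  have cy : col y ≠ col (c (j + 2)) := by
    have := H.col_c j 1
    simp at this
    rw [this, hyb]; exact cb
  rw [H.dC_eq cy]
  have hconn : Conn G c b a (2 * k) := Conn.symm ⟨l, hl, ho, hlen⟩
  have := H.two_le
  obtain ⟨p, hp, e⟩ := H.exists_slot ha ca
  rw [mem_slots] at hp
  have := H.conn_gap hconn hb hp.2 (H.ne_of_lt (by omega) (by omega)) (by omega) (by omega)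
  have := num_single (p := p) (r := k + 1) (T := slots G c t (j + 2) y) (t := t)
    (fun p hp => (mem_slots.1 hp).1) (by omega) (by omega) (by
      intro u hu v hv hup hpv
      rw [mem_slots] at hu hv
      have := H.cyc2 hl.reverse (by simpa using ho) hy (by simpa using hyl) hb hp.2 hu.2 hv.2
        (by omega) (by omega) (by omega) (by omega)
      rw [List.length_reverse] at this
      omega)
  omega

end LC

end

section
open Finset
open scoped Classical

variable {V : Type} {G : SimpleGraph V} {col : V → Bool} {t : ℕ} {c : ℤ → V}

namespace LC

lemma gap_one_side' [Fintype V] (H : LC G col t c) {a b : V} {n : ℕ} (h : Conn G c a b n)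
    (hn : 1 ≤ n) (hc : col a = col b) (hb : 1 ≤ dC G c b) :
    dC G c a ≤ 1 ∨ dC G c a + n ≤ t + 2 := by
  have := H.gap_one_side (k := (n + 1) / 2) (h.mono (by omega)) (by omega) hc hb
  omega

end LC

/-- The number of neighbours in `U`. -/
noncomputable def dU (G : SimpleGraph V) (U : Finset V) (w : V) : ℕ := #{x ∈ U | G.Adj w x}

lemma dU_mono {U W : Finset V} (h : U ⊆ W) (w : V) : dU G U w ≤ dU G W w :=
  card_le_card (filter_subset_filter _ h)

lemma dU_pos {U : Finset V} {w : V} : 1 ≤ dU G U w ↔ ∃ x ∈ U, G.Adj w x := by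
  rw [dU, Nat.succ_le_iff, card_pos]
  simp [Finset.Nonempty]

lemma dU_erase {U : Finset V} {v w : V} (hv : v ∈ U) :
    dU G U w = dU G (U.erase v) w + if G.Adj w v then 1 else 0 := by
  rw [dU, dU, filter_erase]
  split_ifs with h
  · rw [card_erase_add_one (by simp [hv, h])]
  · rw [erase_eq_of_notMem (by simp [h])]; rfl

variable [Fintype V]

/-- Twice the number of edges with an end in `U`, when those edges join `U` to `U` or the cycle. -/
noncomputable def F2 (G : SimpleGraph V) (c : ℤ → V) (U : Finset V) : ℕ :=
  ∑ v ∈ U, (dU G U v + 2 * dC G c v)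

lemma F2_erase {U : Finset V} {v : V} (hv : v ∈ U) :
    F2 G c U = F2 G c (U.erase v) + 2 * (dU G U v + dC G c v) := by
  rw [F2, F2, ← add_sum_erase _ _ hv]
  have e : ∑ x ∈ U.erase v, (dU G U x + 2 * dC G c x) =
      ∑ x ∈ U.erase v, (dU G (U.erase v) x + 2 * dC G c x) +
        ∑ x ∈ U.erase v, (if G.Adj x v then 1 else 0) := by
    rw [← sum_add_distrib]
    refine sum_congr rfl fun x hx => ?_
    rw [dU_erase hv]; ring
  have e2 : ∑ x ∈ U.erase v, (if G.Adj x v then 1 else 0) = dU G U v := by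
    rw [← card_filter, dU]
    congr 1
    ext x
    simp only [mem_filter, mem_erase]
    exact ⟨fun h => ⟨h.1.2, h.2.symm⟩, fun h => ⟨⟨h.2.ne', h.1⟩, h.2.symm⟩⟩
  rw [e, e2]; ring

lemma F2_sdiff_le {U W : Finset V} (hW : W ⊆ U) :
    F2 G c U ≤ F2 G c (U \ W) + 2 * ∑ v ∈ W, (dU G U v + dC G c v) := by
  induction W using Finset.induction_on generalizing U with
  | empty => simp
  | insert v W hv ih =>
    have hvU : v ∈ U := hW (mem_insert_self _ _)
    rw [F2_erase hvU, sum_insert hv]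
    have h1 := ih (U := U.erase v) (fun x hx => mem_erase.2
      ⟨fun e => hv (e ▸ hx), hW (mem_insert_of_mem hx)⟩)
    have h2 : U.erase v \ W = U \ insert v W := by ext x; simp; tauto
    have h3 : ∑ x ∈ W, (dU G (U.erase v) x + dC G c x) ≤ ∑ x ∈ W, (dU G U x + dC G c x) :=
      sum_le_sum fun x _ => Nat.add_le_add_right (dU_mono (erase_subset _ _) x) _
    rw [h2] at h1
    omega

/-- The vertices of `U` of a given colour. -/
noncomputable def part (col : V → Bool) (U : Finset V) (s : Bool) : Finset V := {v ∈ U | col v = s}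

omit [Fintype V] in
lemma mem_part {U : Finset V} {s : Bool} {v : V} : v ∈ part col U s ↔ v ∈ U ∧ col v = s := by
  simp [part]

/-- A set of vertices outside the cycle from which no subset can be removed cheaply. -/
structure Irr (G : SimpleGraph V) (col : V → Bool) (t : ℕ) (c : ℤ → V) (w : Bool → ℕ)
    (U : Finset V) : Prop where
  out : ∀ v ∈ U, Out c v
  card : ∀ s, #(part col U s) ≤ t
  sum : ∀ s, w s + w (!s) = 2 * t + 2
  two_le : ∀ s, 2 ≤ w s
  dC_le : ∀ v ∈ U, 2 * dC G c v ≤ w (col v)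
  irr : ∀ W ⊆ U, W.Nonempty → F2 G c (U \ W) + ∑ v ∈ W, w (col v) < F2 G c U

/-- A path with all vertices in `U`. -/
def PU (G : SimpleGraph V) (U : Finset V) (l : List V) (a b : V) : Prop :=
  IsP G l a b ∧ ∀ v ∈ l, v ∈ U

/-- A longest path in `U`. -/
def Longest (G : SimpleGraph V) (U : Finset V) (l : List V) (a b : V) : Prop :=
  PU G U l a b ∧ ∀ l' a' b', PU G U l' a' b' → l'.length ≤ l.length

omit [Fintype V] in
lemma PU.reverse {U : Finset V} {l : List V} {a b : V} (h : PU G U l a b) :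
    PU G U l.reverse b a := ⟨h.1.reverse, by simpa using h.2⟩

omit [Fintype V] in
lemma PU.length_le {U : Finset V} {l : List V} {a b : V} (h : PU G U l a b) : l.length ≤ #U := by
  rw [← List.toFinset_card_of_nodup h.1.nodup]
  exact card_le_card fun x hx => h.2 x (by simpa using hx)

omit [Fintype V] in
lemma Longest.reverse {U : Finset V} {l : List V} {a b : V} (h : Longest G U l a b) :
    Longest G U l.reverse b a := ⟨h.1.reverse, by simpa using h.2⟩

omit [Fintype V] in
lemma Longest.of_le {U : Finset V} {l l' : List V} {a b a' b' : V} (h : Longest G U l a b)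
    (h' : PU G U l' a' b') (hl : l.length ≤ l'.length) : Longest G U l' a' b' :=
  ⟨h', fun l'' a'' b'' h'' => (h.2 l'' a'' b'' h'').trans hl⟩

omit [Fintype V] in
lemma exists_longest {U : Finset V} (hU : U.Nonempty) : ∃ l a b, Longest G U l a b := by
  obtain ⟨v, hv⟩ := hU
  let P : ℕ → Prop := fun n => ∃ l a b, PU G U l a b ∧ l.length = n
  have h1 : P 1 := ⟨[v], v, v, ⟨IsP.singleton v, by simpa using hv⟩, rfl⟩
  have hb : ∀ n, P n → n ≤ #U := by
    rintro n ⟨l, a, b, h, rfl⟩; exact h.length_le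
  obtain ⟨l, a, b, h, hl⟩ := Nat.findGreatest_spec (P := P) (hb 1 h1) h1
  refine ⟨l, a, b, h, fun l' a' b' h' => ?_⟩
  rw [hl]
  exact Nat.le_findGreatest h'.length_le ⟨l', a', b', h', rfl⟩

omit [Fintype V] in
lemma Longest.mem_of_adj {U : Finset V} {l : List V} {a b x : V} (h : Longest G U l a b)
    (hx : x ∈ U) (hax : G.Adj a x) : x ∈ l := by
  by_contra hxl
  have := h.2 ([x] ++ l) x b ⟨(IsP.singleton x).append h.1.1 hax.symm (by simpa using hxl), by
    intro v hv; simp at hv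
    rcases hv with rfl | hv
    exacts [hx, h.1.2 v hv]⟩
  simp at this

omit [Fintype V] in
lemma PU.conn {U : Finset V} (ho : ∀ v ∈ U, Out c v) {l : List V} {a b : V} (h : PU G U l a b)
    {n : ℕ} (hn : n ≤ l.length) : Conn G c a b n := ⟨l, h.1, fun v hv => ho v (h.2 v hv), hn⟩

namespace Irr

variable {w : Bool → ℕ} {U : Finset V} (I : Irr G col t c w U)
include I

lemma rule {R Y : Finset V} {s : Bool} (hR : R ⊆ part col U s) (hY : Y ⊆ part col U (!s))
    (hne : (R ∪ Y).Nonempty) :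
    w s * #R + w (!s) * #Y < 2 * ∑ x ∈ R, (dU G U x + dC G c x) +
      2 * ∑ y ∈ Y, (dU G (U \ R) y + dC G c y) := by
  have hRU : R ⊆ U := fun x hx => (mem_part.1 (hR hx)).1
  have hYU : Y ⊆ U := fun x hx => (mem_part.1 (hY hx)).1
  have hRY : Disjoint R Y := by
    rw [disjoint_left]
    intro x hx hx'
    have h1 := (mem_part.1 (hR hx)).2
    have h2 := (mem_part.1 (hY hx')).2
    rw [h1] at h2
    cases s <;> simp at h2
  have h1 := I.irr (R ∪ Y) (union_subset hRU hYU) hne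
  have h2 := F2_sdiff_le (G := G) (c := c) hRU
  have h3 := F2_sdiff_le (G := G) (c := c) (U := U \ R) (W := Y) (fun y hy => mem_sdiff.2
    ⟨hYU hy, fun hy' => disjoint_left.1 hRY hy' hy⟩)
  rw [sdiff_sdiff_left, Finset.sup_eq_union] at h3
  rw [sum_union hRY, sum_congr rfl (fun x hx => by rw [(mem_part.1 (hR hx)).2] :
    ∀ x ∈ R, w (col x) = w s), sum_congr rfl (fun x hx => by rw [(mem_part.1 (hY hx)).2] :
    ∀ x ∈ Y, w (col x) = w (!s))] at h1
  simp only [sum_const, smul_eq_mul] at h1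
  rw [mul_comm (w s), mul_comm (w (!s))]
  omega

lemma deg {x : V} (hx : x ∈ U) : w (col x) + 1 ≤ 2 * (dU G U x + dC G c x) := by
  have := I.rule (R := {x}) (Y := ∅) (s := col x) (by simpa [mem_part] using hx) (by simp)
    (by simp)
  simp at this
  omega

lemma one_le_dU {x : V} (hx : x ∈ U) : 1 ≤ dU G U x := by
  have := I.deg hx
  have := I.dC_le x hx
  omega

lemma deg_pair {x y : V} (hx : x ∈ U) (hy : y ∈ U) (hc : col y ≠ col x) :
    t + 2 ≤ dU G U x + dC G c x + (dU G U y + dC G c y) := by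
  have h1 := I.deg hx
  have h2 := I.deg hy
  have h3 := I.sum (col x)
  rw [Bool.eq_not_of_ne hc] at h2
  omega

end Irr

lemma dU_sdiff_le (bip : ∀ u v, G.Adj u v → col u ≠ col v) {U R : Finset V} {s : Bool} {y : V}
    (hy : col y = !s) (hR : R ⊆ part col U s) : dU G (U \ R) y ≤ #(part col U s) - #R := by
  rw [← card_sdiff_of_subset hR]
  refine card_le_card fun x hx => ?_
  simp only [mem_filter, mem_sdiff, mem_part] at hx ⊢
  refine ⟨⟨hx.1.1, ?_⟩, hx.1.2⟩
  have := bip _ _ hx.2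
  rw [hy] at this
  revert this
  cases s <;> cases col x <;> simp

lemma dU_le_part (bip : ∀ u v, G.Adj u v → col u ≠ col v) {U : Finset V} {s : Bool} {y : V}
    (hy : col y = !s) : dU G U y ≤ #(part col U s) := by
  simpa using dU_sdiff_le (R := ∅) bip hy (empty_subset _)

namespace Irr

variable {w : Bool → ℕ} {U : Finset V} (I : Irr G col t c w U)
include I

lemma rule' (bip : ∀ u v, G.Adj u v → col u ≠ col v) {R Y : Finset V} {s : Bool}
    (hR : R ⊆ part col U s) (hY : Y ⊆ part col U (!s)) (hne : (R ∪ Y).Nonempty) :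
    w s * #R + w (!s) * #Y < 2 * ∑ x ∈ R, (dU G U x + dC G c x) +
      2 * (#Y * (t - #R)) + 2 * ∑ y ∈ Y, dC G c y := by
  have h1 := I.rule hR hY hne
  have h2 : ∑ y ∈ Y, (dU G (U \ R) y + dC G c y) ≤ ∑ y ∈ Y, ((t - #R) + dC G c y) := by
    refine sum_le_sum fun y hy => Nat.add_le_add_right ?_ _
    have := I.card s
    have := dU_sdiff_le bip (mem_part.1 (hY hy)).2 hR
    omega
  rw [sum_add_distrib (f := fun _ => t - #R), sum_const, smul_eq_mul] at h2
  omega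

end Irr

/-! ### Rotations -/

omit [Fintype V] in
lemma IsP.rotate {l : List V} {a b : V} (h : IsP G l a b) {i : ℕ} (hi : i + 1 < l.length)
    (ha : G.Adj a l[i + 1]) :
    IsP G ((l.take (i + 1)).reverse ++ l.drop (i + 1)) l[i] b :=
  (h.take (by omega)).reverse.append (h.drop hi) ha (fun v hv => by
    rw [List.mem_reverse] at hv; exact h.mem_take_drop le_rfl hv)

omit [Fintype V] in
lemma mem_rotate {l : List V} {i : ℕ} {v : V} :
    v ∈ (l.take i).reverse ++ l.drop i ↔ v ∈ l := by
  rw [List.mem_append, List.mem_reverse, ← List.mem_append, List.take_append_drop]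

omit [Fintype V] in
lemma length_rotate {l : List V} {i : ℕ} : ((l.take i).reverse ++ l.drop i).length = l.length := by
  simp; omega

omit [Fintype V] in
lemma PU.rotate {U : Finset V} {l : List V} {a b : V} (h : PU G U l a b) {i : ℕ}
    (hi : i + 1 < l.length) (ha : G.Adj a l[i + 1]) :
    PU G U ((l.take (i + 1)).reverse ++ l.drop (i + 1)) l[i] b :=
  ⟨h.1.rotate hi ha, fun v hv => h.2 v (mem_rotate.1 hv)⟩

omit [Fintype V] in
lemma Longest.rotate {U : Finset V} {l : List V} {a b : V} (h : Longest G U l a b) {i : ℕ}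
    (hi : i + 1 < l.length) (ha : G.Adj a l[i + 1]) :
    Longest G U ((l.take (i + 1)).reverse ++ l.drop (i + 1)) l[i] b :=
  h.of_le (h.1.rotate hi ha) length_rotate.ge

omit [Fintype V] in
/-- Changing the starting point of a closed list. -/
lemma IsP.shift {l : List V} {a b : V} (h : IsP G l a b) (hba : G.Adj b a) {i : ℕ}
    (hi : i + 1 < l.length) : IsP G (l.drop (i + 1) ++ l.take (i + 1)) l[i + 1] l[i] :=
  (h.drop hi).append (h.take (by omega)) hba (fun _ hv hv' => h.mem_take_drop le_rfl hv' hv)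

omit [Fintype V] in
lemma mem_shift {l : List V} {i : ℕ} {v : V} : v ∈ l.drop i ++ l.take i ↔ v ∈ l := by
  rw [List.mem_append, or_comm, ← List.mem_append, List.take_append_drop]

omit [Fintype V] in
lemma length_shift {l : List V} {i : ℕ} : (l.drop i ++ l.take i).length = l.length := by
  simp; omega

omit [Fintype V] in
/-- A closed list can be made to start anywhere. -/
lemma exists_shift {l : List V} {a b u : V} (h : IsP G l a b) (hba : G.Adj b a) (hu : u ∈ l) :
    ∃ l' v, IsP G l' u v ∧ G.Adj v u ∧ l'.length = l.length ∧ ∀ x, x ∈ l' ↔ x ∈ l := by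
  obtain ⟨i, hi, rfl⟩ := List.getElem_of_mem hu
  cases i with
  | zero =>
    refine ⟨l, b, by rw [h.head_eq]; exact h, by rwa [h.head_eq], rfl, fun _ => Iff.rfl⟩
  | succ i =>
    exact ⟨_, _, h.shift hba hi, h.adj hi, length_shift, fun x => mem_shift⟩

omit [Fintype V] in
lemma exists_arc {l : List V} {a b u v : V} (h : IsP G l a b) (hba : G.Adj b a) {k : ℕ}
    (hk : 2 * k ≤ l.length) (hu : u ∈ l) (hv : v ∈ l) (huv : u ≠ v) :
    ∃ l', IsP G l' u v ∧ k + 1 ≤ l'.length ∧ ∀ x ∈ l', x ∈ l := by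
  obtain ⟨D, z, h1, h2, h3, h4⟩ := exists_shift h hba hu
  obtain ⟨m, hm, rfl⟩ := List.getElem_of_mem ((h4 v).2 hv)
  have hm0 : m ≠ 0 := by rintro rfl; exact huv h1.head_eq.symm
  by_cases hmk : k ≤ m
  · refine ⟨_, h1.take hm, by simp; omega, fun x hx => (h4 x).1 (List.mem_of_mem_take hx)⟩
  · refine ⟨[u] ++ (D.drop m).reverse, (IsP.singleton u).append (h1.drop hm).reverse h2.symm ?_,
      by simp; omega, ?_⟩
    · intro x hx hx'
      simp at hx
      subst hx
      rw [List.mem_reverse] at hx'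
      refine h1.mem_take_drop (i := 1) (j := m) (by omega) ?_ hx'
      have := (h1.take (i := 0) h1.length_pos).head_mem
      simpa using this
    · intro x hx
      simp at hx
      rcases hx with rfl | hx
      · exact hu
      · exact (h4 x).1 (List.mem_of_mem_drop hx)

/-- Indices of the neighbours of `a` on the list. -/
noncomputable def nidx (G : SimpleGraph V) (l : List V) (a : V) : Finset ℕ :=
  {i ∈ range l.length | ∃ h : i < l.length, G.Adj a l[i]}

omit [Fintype V] in
lemma mem_nidx {l : List V} {a : V} {i : ℕ} :
    i ∈ nidx G l a ↔ ∃ h : i < l.length, G.Adj a l[i] := by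
  simp only [nidx, mem_filter, mem_range]
  exact ⟨fun h => h.2, fun h => ⟨h.1, h⟩⟩

omit [Fintype V] in
lemma card_nidx {U : Finset V} {l : List V} {a : V} (hn : l.Nodup) (hU : ∀ x ∈ l, x ∈ U)
    (h : ∀ x ∈ U, G.Adj a x → x ∈ l) : dU G U a = #(nidx G l a) := by
  symm
  refine card_bij (fun i _ => l.getD i a) ?_ ?_ ?_
  · intro i hi
    obtain ⟨hi, h⟩ := mem_nidx.1 hi
    rw [List.getD_eq_getElem _ _ hi]
    simp [h, hU]
  · intro i hi j hj e
    obtain ⟨hi, -⟩ := mem_nidx.1 hi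
    obtain ⟨hj, -⟩ := mem_nidx.1 hj
    rw [List.getD_eq_getElem _ _ hi, List.getD_eq_getElem _ _ hj] at e
    exact hn.getElem_inj_iff.1 e
  · intro x hx
    rw [mem_filter] at hx
    obtain ⟨i, hi, rfl⟩ := List.getElem_of_mem (h x hx.1 hx.2)
    exact ⟨i, mem_nidx.2 ⟨hi, hx.2⟩, List.getD_eq_getElem _ _ hi⟩

omit [Fintype V] in
lemma Longest.card_nidx {U : Finset V} {l : List V} {a b : V} (h : Longest G U l a b) :
    dU G U a = #(nidx G l a) :=
  BipCycle.card_nidx h.1.1.nodup h.1.2 fun _ hx hax => h.mem_of_adj hx hax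

omit [Fintype V] in
lemma nidx_odd (bip : ∀ u v, G.Adj u v → col u ≠ col v) {l : List V} {a b x : V} (h : IsP G l a b)
    (hx : col x = col a) {i : ℕ} (hi : i ∈ nidx G l x) : i % 2 = 1 := by
  obtain ⟨hi, hadj⟩ := mem_nidx.1 hi
  have h1 := col_getElem bip h i hi
  have h2 := bip _ _ hadj
  rw [h1, hx] at h2
  by_contra hc
  simp [hc] at h2

omit [Fintype V] in
lemma nidx_even (bip : ∀ u v, G.Adj u v → col u ≠ col v) {l : List V} {a b x : V} (h : IsP G l a b)
    (hx : col x ≠ col a) {i : ℕ} (hi : i ∈ nidx G l x) : i % 2 = 0 := by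
  obtain ⟨hi, hadj⟩ := mem_nidx.1 hi
  have h1 := col_getElem bip h i hi
  have h2 := bip _ _ hadj
  rw [h1] at h2
  by_contra hc
  have : i % 2 = 1 := by omega
  rw [this] at h2
  revert h2 hx
  cases col x <;> cases col a <;> simp

/-- Vertices of the list at positions in `S`. -/
noncomputable def at' (l : List V) (a : V) (S : Finset ℕ) : Finset V := S.image fun i => l.getD i a

omit [Fintype V] in
lemma mem_at' {l : List V} {a v : V} {S : Finset ℕ} (hS : ∀ i ∈ S, i < l.length) :
    v ∈ at' l a S ↔ ∃ i, ∃ h : i < l.length, i ∈ S ∧ l[i] = v := by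
  simp only [at', mem_image]
  constructor
  · rintro ⟨i, hi, rfl⟩
    exact ⟨i, hS i hi, hi, (List.getD_eq_getElem _ _ _).symm⟩
  · rintro ⟨i, h, hi, rfl⟩
    exact ⟨i, hi, List.getD_eq_getElem _ _ _⟩

omit [Fintype V] in
lemma card_at' {l : List V} {a : V} (hl : l.Nodup) {S : Finset ℕ} (hS : ∀ i ∈ S, i < l.length) :
    #(at' l a S) = #S := by
  refine card_image_of_injOn ?_
  intro i hi j hj e
  simp only [] at e
  rw [List.getD_eq_getElem _ _ (hS i hi), List.getD_eq_getElem _ _ (hS j hj)] at e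
  exact hl.getElem_inj_iff.1 e

omit [Fintype V] in
/-- The colour classes of a path are balanced up to one. -/
lemma card_part_list (bip : ∀ u v, G.Adj u v → col u ≠ col v) {l : List V} {a b : V}
    (h : IsP G l a b) :
    #(part col l.toFinset (col a)) = (l.length + 1) / 2 ∧
      #(part col l.toFinset (!col a)) = l.length / 2 := by
  have h1 : part col l.toFinset (col a) =
      at' l a ((range ((l.length + 1) / 2)).image fun i => 2 * i) := by
    ext v
    rw [mem_part, List.mem_toFinset, mem_at' (by simp; omega)]
    constructor
    · rintro ⟨h1, h2⟩
      obtain ⟨i, hi, rfl⟩ := List.getElem_of_mem h1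
      rw [col_getElem bip h i hi] at h2
      refine ⟨i, hi, ?_, rfl⟩
      have h3 : i % 2 = 0 := by
        by_contra h
        have : i % 2 = 1 := by omega
        simp [this] at h2
      simp only [mem_image, mem_range]
      exact ⟨i / 2, by omega, by omega⟩
    · rintro ⟨i, hi, hi', rfl⟩
      simp only [mem_image, mem_range] at hi'
      obtain ⟨j, hj, rfl⟩ := hi'
      refine ⟨List.getElem_mem _, ?_⟩
      rw [col_getElem bip h _ hi]; simp
  have h2 : part col l.toFinset (!col a) =
      at' l a ((range (l.length / 2)).image fun i => 2 * i + 1) := by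
    ext v
    rw [mem_part, List.mem_toFinset, mem_at' (by simp; omega)]
    constructor
    · rintro ⟨h1, h2⟩
      obtain ⟨i, hi, rfl⟩ := List.getElem_of_mem h1
      rw [col_getElem bip h i hi] at h2
      refine ⟨i, hi, ?_, rfl⟩
      have h3 : i % 2 = 1 := by
        by_contra h
        simp [h] at h2
      simp only [mem_image, mem_range]
      exact ⟨i / 2, by omega, by omega⟩
    · rintro ⟨i, hi, hi', rfl⟩
      simp only [mem_image, mem_range] at hi'
      obtain ⟨j, hj, rfl⟩ := hi'
      refine ⟨List.getElem_mem _, ?_⟩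
      rw [col_getElem bip h _ hi]; simp [Nat.add_mod]
  rw [h1, h2, card_at' h.nodup (by simp; omega), card_at' h.nodup (by simp; omega),
    card_image_of_injective, card_image_of_injective, card_range, card_range]
  · exact ⟨rfl, rfl⟩
  · intro i j h; simp at h; omega
  · intro i j h; simp at h; omega

end

section
open Finset
open scoped Classical

variable {V : Type} {G : SimpleGraph V} {col : V → Bool} {t : ℕ} {c : ℤ → V}

lemma nidx_pos {l : List V} {a b : V} (h : IsP G l a b) {i : ℕ} (hi : i ∈ nidx G l a) :
    1 ≤ i := by
  rcases Nat.eq_zero_or_pos i with rfl | h'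
  · obtain ⟨h1, h2⟩ := mem_nidx.1 hi
    rw [h.head_eq] at h2
    exact (G.loopless.irrefl _ h2).elim
  · exact h'

/-- The vertices of a path before its neighbours of the starting point. -/
lemma pred_set (bip : ∀ u v, G.Adj u v → col u ≠ col v) {U : Finset V} {l : List V} {a b : V}
    (h : PU G U l a b) {S : Finset ℕ} (hS : S ⊆ nidx G l a) :
    at' l a (S.image (· - 1)) ⊆ part col U (col a) ∧ #(at' l a (S.image (· - 1))) = #S ∧
      ∀ x ∈ at' l a (S.image (· - 1)), ∃ i, ∃ h : i + 1 < l.length, i + 1 ∈ S ∧ x = l[i] := by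
  have hlt : ∀ i ∈ S.image (· - 1), i < l.length := by
    intro i hi
    obtain ⟨j, hj, rfl⟩ := mem_image.1 hi
    obtain ⟨h1, h2⟩ := mem_nidx.1 (hS hj)
    omega
  have key : ∀ x ∈ at' l a (S.image (· - 1)),
      ∃ i, ∃ h : i + 1 < l.length, i + 1 ∈ S ∧ x = l[i] := by
    intro x hx
    rw [mem_at' hlt] at hx
    obtain ⟨i, hi, hi', rfl⟩ := hx
    obtain ⟨j, hj, rfl⟩ := mem_image.1 hi'
    have h1 := nidx_pos h.1 (hS hj)
    have e : j - 1 + 1 = j := by omega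
    refine ⟨j - 1, ?_, by rwa [e], rfl⟩
    obtain ⟨h1, h2⟩ := mem_nidx.1 (hS hj)
    omega
  refine ⟨?_, ?_, key⟩
  · intro x hx
    obtain ⟨i, hi, hi', rfl⟩ := key x hx
    have h1 := nidx_odd bip h.1 rfl (hS hi')
    have h2 : i % 2 = 0 := by omega
    rw [mem_part, col_getElem bip h.1]
    exact ⟨h.2 _ (List.getElem_mem _), by simp [h2]⟩
  · rw [card_at' h.1.nodup hlt, card_image_of_injOn]
    intro i hi j hj e
    have := nidx_pos h.1 (hS hi)
    have := nidx_pos h.1 (hS hj)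
    simp only [] at e
    omega

lemma nbr_set (bip : ∀ u v, G.Adj u v → col u ≠ col v) {U : Finset V} {l : List V} {a b : V}
    (h : PU G U l a b) {S : Finset ℕ} (hS : S ⊆ nidx G l a) :
    at' l a S ⊆ part col U (!col a) ∧ #(at' l a S) = #S ∧
      ∀ x ∈ at' l a S, ∃ i, ∃ h : i < l.length, i ∈ S ∧ x = l[i] := by
  have hlt : ∀ i ∈ S, i < l.length := fun i hi => (mem_nidx.1 (hS hi)).1
  have key : ∀ x ∈ at' l a S, ∃ i, ∃ h : i < l.length, i ∈ S ∧ x = l[i] := by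
    intro x hx
    rw [mem_at' hlt] at hx
    obtain ⟨i, hi, hi', rfl⟩ := hx
    exact ⟨i, hi, hi', rfl⟩
  refine ⟨?_, card_at' h.1.nodup hlt, key⟩
  intro x hx
  obtain ⟨i, hi, hi', rfl⟩ := key x hx
  have h1 := nidx_odd bip h.1 rfl (hS hi')
  rw [mem_part, col_getElem bip h.1]
  exact ⟨h.2 _ (List.getElem_mem _), by simp [h1]⟩

variable [Fintype V]

lemma sum_dC_le (H : LC G col t c) {R : Finset V} {s : Bool} (hs : ∀ x ∈ R, col x = s) {k : ℕ}
    (hk : #R = k) (hkt : k ≤ t) (hconn : ∀ x ∈ R, ∀ y ∈ R, x ≠ y → Conn G c x y (k + 1)) :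
    ∑ x ∈ R, dC G c x + k * k ≤ k * (t + 1) := by
  by_cases h : ∃ x ∈ R, t + 2 ≤ dC G c x + k
  · obtain ⟨x, hx, hxk⟩ := h
    have h0 : ∀ u ∈ R, u ≠ x → dC G c u = 0 := by
      intro u hu hux
      by_contra hc
      have := H.gap_one_side' (hconn x hx u hu hux.symm) (by omega) ((hs x hx).trans (hs u hu).symm)
        (by omega)
      omega
    rw [sum_eq_single x h0 (fun h => (h hx).elim)]
    have h1 := H.dC_le x
    have h2 : 1 ≤ k := hk ▸ card_pos.2 ⟨x, hx⟩
    nlinarith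
  · push Not at h
    have h1 : ∑ x ∈ R, dC G c x ≤ ∑ x ∈ R, (t + 1 - k) :=
      sum_le_sum fun x hx => by have := h x hx; omega
    rw [sum_const, smul_eq_mul, hk] at h1
    obtain ⟨m, rfl⟩ := Nat.exists_eq_add_of_le hkt
    have : k + m + 1 - k = m + 1 := by omega
    rw [this] at h1
    nlinarith

namespace Irr

variable {w : Bool → ℕ} {U : Finset V} (H : LC G col t c) (I : Irr G col t c w U)
include H I

/-- A longest path in `U` does not close up to a cycle. -/
lemma not_closed {l : List V} {a b : V} (h : Longest G U l a b) : ¬ G.Adj b a := by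
  intro hba
  have hcol := H.bip _ _ hba
  have hodd := odd_length H.bip h.1.1
  simp only [hcol.symm, iff_false] at hodd
  obtain ⟨k, hk⟩ : ∃ k, l.length = 2 * k := ⟨l.length / 2, by omega⟩
  have hpos := h.1.1.length_pos
  obtain ⟨cR, cY⟩ := card_part_list H.bip h.1.1
  set s := col a
  set R := part col l.toFinset s
  set Y := part col l.toFinset (!s)
  have cR' : #R = k := by omega
  have cY' : #Y = k := by omega
  have hlU : ∀ v ∈ l.toFinset, v ∈ U := fun v hv => h.1.2 v (by simpa using hv)
  have hR : R ⊆ part col U s := filter_subset_filter _ hlU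
  have hY : Y ⊆ part col U (!s) := filter_subset_filter _ hlU
  have hkt : k ≤ t := by
    have := card_le_card hR
    have := I.card s
    omega
  have hnb : ∀ u ∈ l, ∀ x ∈ U, G.Adj u x → x ∈ l := by
    intro u hu x hx hux
    obtain ⟨l', v, h1, h2, h3, h4⟩ := exists_shift h.1.1 hba hu
    have : Longest G U l' u v := h.of_le ⟨h1, fun y hy => h.1.2 y ((h4 y).1 hy)⟩ h3.ge
    exact (h4 x).1 (this.mem_of_adj hx hux)
  have hconn : ∀ u ∈ l, ∀ v ∈ l, u ≠ v → Conn G c u v (k + 1) := by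
    intro u hu v hv huv
    obtain ⟨l', h1, h2, h3⟩ := exists_arc h.1.1 hba hk.ge hu hv huv
    exact ⟨l', h1, fun x hx => I.out x (h.1.2 x (h3 x hx)), h2⟩
  have mR : ∀ x ∈ R, x ∈ l ∧ col x = s := fun x hx => by
    have := mem_part.1 hx; simpa using this
  have mY : ∀ x ∈ Y, x ∈ l ∧ col x = !s := fun x hx => by
    have := mem_part.1 hx; simpa using this
  have rule := I.rule hR hY (by
    have : 0 < #R := by omega
    exact (card_pos.1 this).mono subset_union_left)
  have e1 : ∑ x ∈ R, (dU G U x + dC G c x) ≤ k * k + ∑ x ∈ R, dC G c x := by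
    rw [sum_add_distrib]
    refine Nat.add_le_add_right ?_ _
    refine (sum_le_card_nsmul _ _ k ?_).trans (by simp [cR'])
    intro x hx
    rw [← cY', dU]
    refine card_le_card fun z hz => ?_
    rw [mem_filter] at hz
    rw [mem_part, List.mem_toFinset]
    refine ⟨hnb x (mR x hx).1 z hz.1 hz.2, ?_⟩
    have := H.bip _ _ hz.2
    rw [(mR x hx).2] at this
    exact Bool.eq_not_of_ne this.symm
  have e2 : ∑ y ∈ Y, (dU G (U \ R) y + dC G c y) = ∑ y ∈ Y, dC G c y := by
    refine sum_congr rfl fun y hy => ?_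
    have : ¬ 1 ≤ dU G (U \ R) y := by
      rw [dU_pos]
      rintro ⟨x, hx, hyx⟩
      rw [mem_sdiff] at hx
      refine hx.2 (mem_part.2 ⟨List.mem_toFinset.2 (hnb y (mY y hy).1 x hx.1 hyx), ?_⟩)
      have := H.bip _ _ hyx
      rw [(mY y hy).2] at this
      revert this
      cases s <;> cases col x <;> simp
    omega
  rw [e2, cR', cY'] at rule
  have hsum := I.sum s
  have rule' : (2 * t + 2) * k < 2 * (k * k + ∑ x ∈ R, dC G c x) + 2 * ∑ y ∈ Y, dC G c y := by
    rw [← hsum, add_mul]; omega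
  have main : ∑ x ∈ R, dC G c x + ∑ y ∈ Y, dC G c y + k * k ≤ k * (t + 1) := by
    by_cases hx : ∃ x ∈ R, 1 ≤ dC G c x
    · by_cases hy : ∃ y ∈ Y, 1 ≤ dC G c y
      · obtain ⟨x, hx, hx1⟩ := hx
        obtain ⟨y, hy, hy1⟩ := hy
        obtain ⟨x0, hx0, mx⟩ := exists_max_image R (dC G c) ⟨x, hx⟩
        obtain ⟨y0, hy0, my⟩ := exists_max_image Y (dC G c) ⟨y, hy⟩
        have c0 : col x0 ≠ col y0 := by
          rw [(mR x0 hx0).2, (mY y0 hy0).2]; simp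
        have g := H.gap_opp (hconn x0 (mR x0 hx0).1 y0 (mY y0 hy0).1 (fun e => c0 (by rw [e])))
          (by omega) c0 (hx1.trans (mx x hx)) (hy1.trans (my y hy))
        have s1 := sum_le_card_nsmul R (dC G c) (dC G c x0) mx
        have s2 := sum_le_card_nsmul Y (dC G c) (dC G c y0) my
        rw [smul_eq_mul, cR'] at s1
        rw [smul_eq_mul, cY'] at s2
        nlinarith
      · push Not at hy
        have : ∑ y ∈ Y, dC G c y = 0 := sum_eq_zero fun y hy' => by have := hy y hy'; omega
        have := sum_dC_le H (fun x hx => (mR x hx).2) cR' hkt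
          (fun x hx y hy hxy => hconn x (mR x hx).1 y (mR y hy).1 hxy)
        omega
    · push Not at hx
      have : ∑ y ∈ R, dC G c y = 0 := sum_eq_zero fun y hy' => by have := hx y hy'; omega
      have := sum_dC_le H (fun x hx => (mY x hx).2) cY' hkt
        (fun x hx y hy hxy => hconn x (mY x hx).1 y (mY y hy).1 hxy)
      omega
  nlinarith

lemma even_dU_add_le {l : List V} {a b : V} (h : Longest G U l a b) {k : ℕ}
    (hk : l.length = 2 * k) : dU G U a + dU G U b ≤ k := by
  have hcol : col a ≠ col b := fun e => by
    have := (odd_length H.bip h.1.1).2 e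
    omega
  have e1 := h.card_nidx
  have e2 : dU G U b = #(nidx G l b) := card_nidx h.1.1.nodup h.1.2 fun x hx hbx => by
    simpa using h.reverse.mem_of_adj hx hbx
  have hd : Disjoint (nidx G l a) ((nidx G l b).image (· + 1)) := by
    rw [disjoint_left]
    intro i hi hi'
    obtain ⟨j, hj, rfl⟩ := mem_image.1 hi'
    obtain ⟨h1, h2⟩ := mem_nidx.1 hi
    obtain ⟨h3, h4⟩ := mem_nidx.1 hj
    exact I.not_closed H (h.rotate h1 h2) h4
  have hs : nidx G l a ∪ (nidx G l b).image (· + 1) ⊆ (range k).image fun i => 2 * i + 1 := by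
    intro i hi
    rw [mem_union] at hi
    simp only [mem_image, mem_range]
    rcases hi with hi | hi
    · have := nidx_odd H.bip h.1.1 rfl hi
      obtain ⟨h1, h2⟩ := mem_nidx.1 hi
      exact ⟨i / 2, by omega, by omega⟩
    · obtain ⟨j, hj, rfl⟩ := mem_image.1 hi
      have := nidx_even H.bip h.1.1 hcol.symm hj
      obtain ⟨h1, h2⟩ := mem_nidx.1 hj
      exact ⟨j / 2, by omega, by omega⟩
  have := card_le_card hs
  rw [card_union_of_disjoint hd, card_image_of_injective _ (add_left_injective 1),
    card_image_of_injective _ (fun i j h => by simp at h; omega), card_range] at this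
  omega

lemma even_le {l : List V} {a b : V} (h : PU G U l a b) {k : ℕ}
    (hk : l.length = 2 * k) : k ≤ t := by
  have h1 := (card_part_list H.bip h.1).1
  have h2 : part col l.toFinset (col a) ⊆ part col U (col a) :=
    filter_subset_filter _ fun v hv => h.2 v (by simpa using hv)
  have := card_le_card h2
  have := I.card (col a)
  omega

lemma even_not_both {l : List V} {a b : V} (h : Longest G U l a b) {k : ℕ}
    (hk : l.length = 2 * k) (hb : 1 ≤ dC G c b) : dC G c a = 0 := by
  have hcol : col a ≠ col b := fun e => by
    have := (odd_length H.bip h.1.1).2 e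
    omega
  by_contra ha
  have h1 := I.even_dU_add_le H h hk
  have h2 := I.deg_pair (h.1.2 a h.1.1.head_mem) (h.1.2 b h.1.1.last_mem) hcol.symm
  have := h.1.1.length_pos
  have h3 := H.gap_opp (h.1.conn I.out le_rfl) (by omega) hcol (by omega) hb
  omega

lemma even_not_attached {l : List V} {a b : V} (h : Longest G U l a b) {k : ℕ}
    (hk : l.length = 2 * k) : dC G c b = 0 := by
  by_contra hb
  have hb : 1 ≤ dC G c b := by omega
  obtain ⟨a', ha', hmax⟩ := exists_max_image ({x : V | ∃ l', Longest G U l' x b} : Finset V)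
    (dU G U) ⟨a, by simpa using ⟨l, h⟩⟩
  simp only [mem_filter, mem_univ, true_and] at ha' hmax
  obtain ⟨l', h'⟩ := ha'
  have hk' : l'.length = 2 * k := hk ▸ le_antisymm (h.2 _ _ _ h'.1) (h'.2 _ _ _ h.1)
  have hcol : col a' ≠ col b := fun e => by
    have := (odd_length H.bip h'.1.1).2 e
    omega
  clear hk h
  rename_i l₀
  clear l₀ a
  set d := dU G U a' with hd
  have hd' : d = #(nidx G l' a') := h'.card_nidx
  have hd1 : 1 ≤ d := I.one_le_dU (h'.1.2 _ h'.1.1.head_mem)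
  have hkt := I.even_le H h'.1 hk'
  have hsum := I.even_dU_add_le H h' hk'
  have hp := I.deg_pair (h'.1.2 a' h'.1.1.head_mem) (h'.1.2 b h'.1.1.last_mem) hcol.symm
  have ha0 := I.even_not_both H h' hk' hb
  have hdC : t + 2 ≤ dC G c b + k := by omega
  have hne : (nidx G l' a').Nonempty := card_pos.1 (by omega)
  have J1 := (nidx G l' a').max'_mem hne
  have J2 := fun i hi => (nidx G l' a').le_max' i hi
  set J := (nidx G l' a').max' hne
  obtain ⟨r1, r2, r3⟩ := pred_set H.bip h'.1 (S := nidx G l' a') subset_rfl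
  obtain ⟨y1, y2, y3⟩ := nbr_set H.bip h'.1 (S := (nidx G l' a').erase J) (erase_subset _ _)
  set R := at' l' a' ((nidx G l' a').image (· - 1))
  set Y := at' l' a' ((nidx G l' a').erase J)
  rw [card_erase_of_mem J1] at y2
  have rule := I.rule' H.bip r1 y1 (by
    have : 0 < #R := by omega
    exact (card_pos.1 this).mono subset_union_left)
  have s1 : ∑ x ∈ R, (dU G U x + dC G c x) ≤ #R • d := by
    refine sum_le_card_nsmul _ _ _ fun x hx => ?_
    obtain ⟨i, hi, hi', rfl⟩ := r3 x hx
    have hl := h'.rotate hi (mem_nidx.1 hi').2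
    have := hmax _ ⟨_, hl⟩
    have := I.even_not_both H hl (length_rotate.trans hk') hb
    omega
  have s2 : ∑ y ∈ Y, dC G c y = 0 := by
    refine sum_eq_zero fun y hy => ?_
    obtain ⟨i, hi, hi', rfl⟩ := y3 y hy
    rw [mem_erase] at hi'
    have hiJ : i < J := lt_of_le_of_ne (J2 i hi'.2) hi'.1
    have hodd := nidx_odd H.bip h'.1.1 rfl hi'.2
    obtain ⟨J3, J4⟩ := mem_nidx.1 J1
    have hc : Conn G c l'[i] b (k + 1) := by
      by_cases hik : i < k
      · exact ⟨_, h'.1.1.drop hi, fun v hv => I.out v (h'.1.2 v (List.mem_of_mem_drop hv)),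
          by simp; omega⟩
      · refine ⟨(l'.take (i + 1)).reverse ++ l'.drop J, (h'.1.1.take hi).reverse.append
          (h'.1.1.drop J3) J4 ?_, ?_, ?_⟩
        · intro v hv hv'
          rw [List.mem_reverse] at hv
          exact h'.1.1.mem_take_drop (by omega) hv hv'
        · intro v hv
          rw [List.mem_append, List.mem_reverse] at hv
          refine I.out v (h'.1.2 v ?_)
          exact hv.elim List.mem_of_mem_take List.mem_of_mem_drop
        · simp; omega
    by_contra hy0
    have hcb : col b = col l'[i] := by
      rw [col_getElem H.bip h'.1.1 i hi, hodd]
      revert hcol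
      cases col a' <;> cases col b <;> simp
    have := H.gap_one_side' hc.symm (by omega) hcb (by omega)
    omega
  rw [s2, r2, y2] at rule
  rw [r2, smul_eq_mul] at s1
  rw [← hd'] at rule s1
  have w1 := I.sum (col a')
  have w2 := I.two_le (col a')
  obtain ⟨e, he⟩ : ∃ e, d = e + 1 := ⟨d - 1, by omega⟩
  obtain ⟨f, hf⟩ : ∃ f, t = d + f := ⟨t - d, by omega⟩
  have w3 : w (!col a') = 2 * t + 2 - w (col a') := by omega
  have e1 : d - 1 = e := by omega
  have e2 : t - d = f := by omega
  rw [e1, e2] at rule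
  have : (2 * t + 2) * e + w (col a') ≤ w (col a') * d + w (!col a') * e := by
    rw [← w1, he]; ring_nf; omega
  rw [he] at s1 hf rule
  rw [hf] at this
  nlinarith

lemma odd_length_of_longest {l : List V} {a b : V} (h : Longest G U l a b) :
    l.length % 2 = 1 := by
  by_contra hc
  obtain ⟨k, hk⟩ : ∃ k, l.length = 2 * k := ⟨l.length / 2, by omega⟩
  have hcol : col a ≠ col b := fun e => by
    have := (odd_length H.bip h.1.1).2 e
    omega
  have h1 := I.even_not_attached H h hk
  have h2 := I.even_not_attached H h.reverse (by simpa using hk)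
  have h3 := I.even_dU_add_le H h hk
  have h4 := I.deg_pair (h.1.2 a h.1.1.head_mem) (h.1.2 b h.1.1.last_mem) hcol.symm
  have h5 := I.even_le H h.1 hk
  omega

end Irr

end

section
open Finset
open scoped Classical

variable {V : Type} {G : SimpleGraph V} {col : V → Bool} {t : ℕ} {c : ℤ → V}
variable [Fintype V]

/-- Lower bounds on the degrees of the vertices of one colour. -/
structure Mode (G : SimpleGraph V) (col : V → Bool) (t : ℕ) (c : ℤ → V) (w : Bool → ℕ)
    (U : Finset V) (s : Bool) (δ : ℕ) : Prop where
  deg : ∀ x ∈ U, col x = s → δ ≤ dU G U x + dC G c x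
  pos : 1 ≤ δ
  mode : t + 3 ≤ 2 * δ ∨ (t + 2 ≤ 2 * δ ∧ w s = w (!s)) ∨
    ∃ y, Out c y ∧ col y ≠ s ∧ 2 ≤ dC G c y ∧ t + 2 ≤ δ + dC G c y

omit [Fintype V] in
lemma card_odd_nidx_le (bip : ∀ u v, G.Adj u v → col u ≠ col v) {l : List V} {a b x : V}
    (h : IsP G l a b) (hx : col x = col a) : #(nidx G l x) ≤ l.length / 2 := by
  have : nidx G l x ⊆ (range (l.length / 2)).image fun i => 2 * i + 1 := by
    intro i hi
    have h1 := nidx_odd bip h hx hi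
    obtain ⟨h2, -⟩ := mem_nidx.1 hi
    simp only [mem_image, mem_range]
    exact ⟨i / 2, by omega, by omega⟩
  refine (card_le_card this).trans (card_image_le.trans (by simp))

omit [Fintype V] in
lemma card_even_nidx_le (bip : ∀ u v, G.Adj u v → col u ≠ col v) {l : List V} {a b x : V}
    (h : IsP G l a b) (hx : col x ≠ col a) : #(nidx G l x) ≤ (l.length + 1) / 2 := by
  have : nidx G l x ⊆ (range ((l.length + 1) / 2)).image fun i => 2 * i := by
    intro i hi
    have h1 := nidx_even bip h hx hi
    obtain ⟨h2, -⟩ := mem_nidx.1 hi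
    simp only [mem_image, mem_range]
    exact ⟨i / 2, by omega, by omega⟩
  refine (card_le_card this).trans (card_image_le.trans (by simp))

omit [Fintype V] in
/-- Inside a path, every vertex at an odd place is joined to an end by a long path. -/
lemma exists_long_to_odd (bip : ∀ u v, G.Adj u v → col u ≠ col v) {l : List V} {a b : V}
    (h : IsP G l a b) (hl : l.length % 2 = 1) {i : ℕ} (hi : i < l.length) (hio : i % 2 = 1) :
    ∃ Q x, IsP G Q x l[i] ∧ (x = a ∨ x = b) ∧ (∀ v ∈ Q, v ∈ l) ∧
      2 * #(nidx G l a) ≤ Q.length := by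
  by_cases hc : 2 * #(nidx G l a) ≤ i + 1
  · exact ⟨_, a, h.take hi, Or.inl rfl, fun v hv => List.mem_of_mem_take hv, by simp; omega⟩
  · set S := {j ∈ nidx G l a | i < j} with hS
    set S' := {j ∈ nidx G l a | ¬ i < j} with hS'
    have hcard : #S + #S' = #(nidx G l a) := card_filter_add_card_filter_not _
    have hS'c : #S' ≤ (i + 1) / 2 := by
      have : S' ⊆ (range ((i + 1) / 2)).image fun i => 2 * i + 1 := by
        intro j hj
        rw [hS', mem_filter] at hj
        have h1 := nidx_odd bip h rfl hj.1
        simp only [mem_image, mem_range]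
        exact ⟨j / 2, by omega, by omega⟩
      refine (card_le_card this).trans (card_image_le.trans (by simp))
    have hne : S.Nonempty := card_pos.1 (by omega)
    have m1 := S.min'_mem hne
    have m2 := fun j hj => S.min'_le j hj
    set s := S.min' hne
    rw [hS, mem_filter] at m1
    obtain ⟨hs1, hs2⟩ := mem_nidx.1 m1.1
    have hso := nidx_odd bip h rfl m1.1
    have hSc : #S ≤ (l.length - s) / 2 := by
      have : S ⊆ (range ((l.length - s) / 2)).image fun i => s + 2 * i := by
        intro j hj
        have h3 := m2 j hj
        rw [hS, mem_filter] at hj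
        have h1 := nidx_odd bip h rfl hj.1
        obtain ⟨h2, -⟩ := mem_nidx.1 hj.1
        simp only [mem_image, mem_range]
        exact ⟨(j - s) / 2, by omega, by omega⟩
      refine (card_le_card this).trans (card_image_le.trans (by simp))
    refine ⟨(l.drop s).reverse ++ l.take (i + 1), b, (h.drop hs1).reverse.append (h.take hi)
      hs2.symm ?_, Or.inr rfl, ?_, ?_⟩
    · intro v hv hv'
      rw [List.mem_reverse] at hv
      exact h.mem_take_drop (by omega) hv' hv
    · intro v hv
      rw [List.mem_append, List.mem_reverse] at hv
      exact hv.elim List.mem_of_mem_drop List.mem_of_mem_take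
    · simp; omega

namespace Irr

variable {w : Bool → ℕ} {U : Finset V} (H : LC G col t c) (I : Irr G col t c w U)
include H I

lemma odd_length_form {l : List V} {a b : V} (h : Longest G U l a b) :
    ∃ k, 2 ≤ k ∧ l.length = 2 * k - 1 ∧ col a = col b ∧ k ≤ t ∧ dU G U a ≤ k - 1 := by
  have h1 := I.odd_length_of_longest H h
  have h2 := (odd_length H.bip h.1.1).1 h1
  have h3 : dU G U a ≤ l.length / 2 := h.card_nidx ▸ card_odd_nidx_le H.bip h.1.1 rfl
  have h4 := I.one_le_dU (h.1.2 a h.1.1.head_mem)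
  have h5 := (card_part_list H.bip h.1.1).1
  have h6 : part col l.toFinset (col a) ⊆ part col U (col a) :=
    filter_subset_filter _ fun v hv => h.1.2 v (by simpa using hv)
  have := card_le_card h6
  have := I.card (col a)
  exact ⟨(l.length + 1) / 2, by omega, by omega, h2, by omega, by omega⟩

set_option maxHeartbeats 1000000 in
lemma odd_not_good {s : Bool} {δ : ℕ} (M : Mode G col t c w U s δ) {l : List V} {a b : V}
    (h : Longest G U l a b) (hs : col a = s) {i j : ℤ} (ha : G.Adj a (c i)) (hb : G.Adj b (c j))
    (hne : c i ≠ c j) : False := by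
  obtain ⟨k, hk, hlen, hab, hkt, hda⟩ := I.odd_length_form H h
  obtain ⟨k', hk', hlen', -, -, hdb⟩ := I.odd_length_form H h.reverse
  have hkk : k' = k := by rw [List.length_reverse] at hlen'; omega
  subst hkk
  have haU := h.1.2 a h.1.1.head_mem
  have hbU := h.1.2 b h.1.1.last_mem
  have da := M.deg a haU hs
  have db := M.deg b hbU (hab ▸ hs)
  have hconn : Conn G c a b (2 * k' - 1) := h.1.conn I.out hlen.ge
  have gap := H.gap_same hconn hk hab ha hb hne.symm
  rcases M.mode with m | ⟨m, mw⟩ | ⟨y, hy, hys, hy2, hyt⟩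
  · omega
  · have hw : w s = t + 1 := by have := I.sum s; omega
    have g2 := H.gap_two hconn ha hb hne
    have ea : dU G U a = k' - 1 := by omega
    have full : ∀ j, j % 2 = 1 → ∀ hj : j < l.length, G.Adj a l[j] := by
      have e1 : #(nidx G l a) = k' - 1 := by rw [← ea, h.card_nidx]
      have hsub : nidx G l a ⊆ (range (k' - 1)).image fun i => 2 * i + 1 := by
        intro i hi
        have h1 := nidx_odd H.bip h.1.1 rfl hi
        obtain ⟨h2, -⟩ := mem_nidx.1 hi
        simp only [mem_image, mem_range]
        exact ⟨i / 2, by omega, by omega⟩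
      have := eq_of_subset_of_card_le hsub (card_image_le.trans (by simp [e1]))
      intro j hj hj'
      have : j ∈ nidx G l a := by
        rw [this]
        simp only [mem_image, mem_range]
        exact ⟨j / 2, by omega, by omega⟩
      exact (mem_nidx.1 this).2
    have l1 : 1 < l.length := by omega
    have hyU : l[1] ∈ U := h.1.2 _ (List.getElem_mem _)
    have hyc : col l[1] = !s := by rw [col_getElem H.bip h.1.1, hs]; simp
    have hdrop := h.1.1.drop l1
    have hy0 : dC G c l[1] = 0 := by
      by_contra hy0
      have c1 : Conn G c l[1] b (2 * k' - 2) :=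
        ⟨_, hdrop, fun v hv => I.out v (h.1.2 v (List.mem_of_mem_drop hv)), by simp; omega⟩
      have hlt : 2 * k' - 3 < l.length := by omega
      have p := h.1.1.take hlt
      have e : 2 * k' - 3 + 1 = 2 * k' - 2 := by omega
      rw [e] at p
      have p2 := p.shift (full _ (by omega) hlt).symm (i := 0) (by simp; omega)
      have e0 : (l.take (2 * k' - 2))[0]'(by simp; omega) = a := by
        rw [List.getElem_take]; exact h.1.1.head_eq
      have e1 : (l.take (2 * k' - 2))[0 + 1]'(by simp; omega) = l[1] := by
        rw [List.getElem_take]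
      rw [e0, e1] at p2
      have c2 : Conn G c l[1] a (2 * k' - 2) := by
        refine ⟨_, p2, fun v hv => I.out v (h.1.2 v ?_), ?_⟩
        · exact List.mem_of_mem_take (mem_shift.1 hv)
        · rw [length_shift]; simp; omega
      have := H.gap_three hk c2 c1 hconn hab (by rw [hyc, hs]; cases s <;> simp) (by omega)
        (H.dC_pos ha)
      omega
    have bound : ∀ z l', Longest G U l' z b → dU G U z + dC G c z ≤ δ := by
      intro z l' h'
      obtain ⟨k₁, hk₁, hlen₁, hzb, -, hdz⟩ := I.odd_length_form H h'
      have hl' := le_antisymm (h.2 _ _ _ h'.1) (h'.2 _ _ _ h.1)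
      have : k₁ = k' := by omega
      subst this
      by_cases hz : dC G c z = 0
      · omega
      · obtain ⟨i', hi'⟩ := H.exists_adj (by omega : 1 ≤ dC G c z)
        obtain ⟨j', hj', hne'⟩ := H.exists_adj_ne (x := c i') (by omega : 2 ≤ dC G c b)
        have := H.gap_same (h'.1.conn I.out hlen₁.ge) hk hzb hi' hj' hne'
        have dz := M.deg z (h'.1.2 z h'.1.1.head_mem) (by rw [hzb, ← hab, hs])
        omega
    have rule := I.rule (R := {z ∈ U | G.Adj l[1] z}) (Y := {l[1]}) (s := s) (by
        intro z hz
        rw [mem_filter] at hz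
        rw [mem_part]
        have := H.bip _ _ hz.2
        refine ⟨hz.1, ?_⟩
        rw [hyc] at this
        revert this
        cases s <;> cases col z <;> simp) (by
        simp [mem_part, hyU, hyc]) (by simp)
    have s1 : ∑ x ∈ {z ∈ U | G.Adj l[1] z}, (dU G U x + dC G c x) ≤
        #{z ∈ U | G.Adj l[1] z} • δ := by
      refine sum_le_card_nsmul _ _ _ fun z hz => ?_
      rw [mem_filter] at hz
      by_cases hzl : z ∈ l
      · obtain ⟨q, hq, rfl⟩ := List.getElem_of_mem hzl
        have hq2 := H.bip _ _ hz.2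
        rw [col_getElem H.bip h.1.1, col_getElem H.bip h.1.1] at hq2
        have hq3 : q % 2 = 0 := by
          by_contra hc
          have : q % 2 = 1 := by omega
          simp [this] at hq2
        by_cases hq4 : q + 1 < l.length
        · exact bound _ _ (h.rotate hq4 (full _ (by omega) hq4))
        · have : q = l.length - 1 := by omega
          subst this
          rw [h.1.1.last_eq]
          omega
      · refine bound z ([z] ++ l.drop 1) (h.of_le ⟨(IsP.singleton z).append hdrop hz.2.symm ?_, ?_⟩ ?_)
        · intro v hv hv'
          simp at hv
          subst hv
          exact hzl (List.mem_of_mem_drop hv')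
        · intro v hv
          simp at hv
          rcases hv with rfl | hv
          · exact hz.1
          · exact h.1.2 v (List.mem_of_mem_tail hv)
        · simp; omega
    have s2 : dU G (U \ {z ∈ U | G.Adj l[1] z}) l[1] = 0 := by
      by_contra hc
      obtain ⟨x, hx, hx'⟩ := dU_pos.1 (Nat.one_le_iff_ne_zero.2 hc)
      simp at hx
      exact hx.2 hx.1 hx'
    have s3 : #{z ∈ U | G.Adj l[1] z} ≤ t := (dU_le_part H.bip hyc).trans (I.card s)
    rw [sum_singleton, s2, hy0, card_singleton, ← mw, hw] at rule
    rw [smul_eq_mul] at s1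
    have e : t + 2 = 2 * δ := by omega
    clear full bound
    generalize #{z ∈ U | G.Adj l[1] z} = N at *
    have e2 : 2 * (N * δ) = N * (t + 2) := by rw [e]; ring
    have e3 : N * (t + 2) = (t + 1) * N + N := by ring
    omega
  · by_cases hyl : y ∈ l
    · obtain ⟨q, hq, rfl⟩ := List.getElem_of_mem hyl
      have c1 : Conn G c a l[q] (q + 1) := ⟨_, h.1.1.take hq,
        fun v hv => I.out v (h.1.2 v (List.mem_of_mem_take hv)), by simp; omega⟩
      have c2 : Conn G c l[q] b (l.length - q) := ⟨_, h.1.1.drop hq,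
        fun v hv => I.out v (h.1.2 v (List.mem_of_mem_drop hv)), by simp⟩
      have g1 := H.gap_opp c1 (by omega) (by rw [hs]; exact hys.symm) (H.dC_pos ha) (by omega)
      have g2 := H.gap_opp c2 (by omega) (by rw [← hab, hs]; exact hys) (by omega) (H.dC_pos hb)
      omega
    · have := H.gap_cross h.1.1 (fun v hv => I.out v (h.1.2 v hv)) hlen.ge (by omega) hy hyl hab
        (by rw [hs]; exact hys) ha hb hne
      omega

lemma odd_not_both {s : Bool} {δ : ℕ} (M : Mode G col t c w U s δ) {l : List V} {a b : V}
    (h : Longest G U l a b) (hs : col a = s) (ha : 1 ≤ dC G c a) (hb : 1 ≤ dC G c b) : False := by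
  obtain ⟨k, hk, hlen, hab, hkt, hda⟩ := I.odd_length_form H h
  have one : ∀ x l', Longest G U l' x b → dC G c x ≤ 1 := by
    intro x l' h'
    by_contra hc
    obtain ⟨j, hj⟩ := H.exists_adj hb
    obtain ⟨i, hi, hne⟩ := H.exists_adj_ne (x := c j) (by omega : 2 ≤ dC G c x)
    obtain ⟨-, -, -, hxb, -, -⟩ := I.odd_length_form H h'
    exact I.odd_not_good H M h' (by rw [hxb, ← hab, hs]) hi hj hne
  have dega := M.deg a (h.1.2 a h.1.1.head_mem) hs
  have ha1 := one a l h
  have hda1 := I.one_le_dU (h.1.2 a h.1.1.head_mem)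
  have un : ∀ y ∈ l, col y = !s → dC G c y = 0 := by
    intro y hy hys
    by_contra hy0
    have trick : ∀ y ∈ l, col y = !s → ∃ Q x, IsP G Q x y ∧ (x = a ∨ x = b) ∧ (∀ v ∈ Q, v ∈ l) ∧
        2 * dU G U a ≤ Q.length := by
      intro y hy hys
      obtain ⟨q, hq, rfl⟩ := List.getElem_of_mem hy
      have : q % 2 = 1 := by
        rw [col_getElem H.bip h.1.1, hs] at hys
        by_contra hc
        simp [hc] at hys
      rw [h.card_nidx]
      exact exists_long_to_odd H.bip h.1.1 (by omega) hq this
    have fin : ∀ x, (x = a ∨ x = b) → col x = s ∧ 1 ≤ dC G c x := by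
      rintro x (rfl | rfl)
      · exact ⟨hs, ha⟩
      · exact ⟨hab ▸ hs, hb⟩
    have main : ∀ y ∈ l, col y = !s → 1 ≤ dC G c y → dC G c y + 2 * dU G U a ≤ t := by
      intro y hy hys hy1
      obtain ⟨Q, x, hQ, hx, hQl, hQn⟩ := trick y hy hys
      obtain ⟨hxs, hx1⟩ := fin x hx
      have := H.gap_opp (a := x) (b := y) (n := 2 * dU G U a)
        ⟨Q, hQ, fun v hv => I.out v (h.1.2 v (hQl v hv)), hQn⟩ (by omega)
        (by rw [hxs, hys]; simp) hx1 hy1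
      omega
    have my := main y hy hys (by omega)
    rcases M.mode with m | ⟨m, -⟩ | ⟨z, hz, hzs, hz2, hzt⟩
    · omega
    · omega
    · have hzs' : col z = !s := Bool.eq_not_of_ne hzs
      by_cases hzl : z ∈ l
      · have := main z hzl hzs' (by omega)
        omega
      · obtain ⟨Q, x, hQ, hx, hQl, hQn⟩ := trick y hy hys
        obtain ⟨hxs, hx1⟩ := fin x hx
        have := H.gap_cross_opp hQ (fun v hv => I.out v (h.1.2 v (hQl v hv))) hQn hz
          (fun hc => hzl (hQl z hc)) (by rw [hxs]; exact hzs) (by rw [hzs', hys]) hx1 (by omega)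
        omega
  obtain ⟨a', ha', hmax⟩ := exists_max_image
    ({x : V | ∃ l', Longest G U l' x b ∧ ∀ v ∈ l', v ∈ l} : Finset V)
    (dU G U) ⟨a, by simpa using ⟨l, h, fun _ h => h⟩⟩
  simp only [mem_filter, mem_univ, true_and] at ha' hmax
  obtain ⟨l', h', hl'⟩ := ha'
  obtain ⟨k', -, -, ha'b, hk't, hda'⟩ := I.odd_length_form H h'
  have hcol : col a' = s := by rw [ha'b, ← hab, hs]
  set d := dU G U a' with hd
  have hd' : d = #(nidx G l' a') := h'.card_nidx
  have hd1 : 1 ≤ d := I.one_le_dU (h'.1.2 _ h'.1.1.head_mem)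
  obtain ⟨r1, r2, r3⟩ := pred_set H.bip h'.1 (S := nidx G l' a') subset_rfl
  obtain ⟨y1, y2, y3⟩ := nbr_set H.bip h'.1 (S := nidx G l' a') subset_rfl
  set R := at' l' a' ((nidx G l' a').image (· - 1))
  set Y := at' l' a' (nidx G l' a')
  have rule := I.rule' H.bip r1 y1 (by
    have : 0 < #R := by omega
    exact (card_pos.1 this).mono subset_union_left)
  have s1 : ∑ x ∈ R, (dU G U x + dC G c x) ≤ #R • (d + 1) := by
    refine sum_le_card_nsmul _ _ _ fun x hx => ?_
    obtain ⟨i, hi, hi', rfl⟩ := r3 x hx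
    have hl := h'.rotate hi (mem_nidx.1 hi').2
    have := hmax _ ⟨_, hl, fun v hv => hl' v (mem_rotate.1 hv)⟩
    have := one _ _ hl
    omega
  have s2 : ∑ y ∈ Y, dC G c y = 0 := by
    refine sum_eq_zero fun y hy => ?_
    have hyc := (mem_part.1 (y1 hy)).2
    obtain ⟨i, hi, hi', rfl⟩ := y3 y hy
    exact un _ (hl' _ (List.getElem_mem _)) (by rw [hyc, hcol])
  rw [s2, r2, y2, ← hd', ← add_mul, I.sum] at rule
  rw [r2, smul_eq_mul, ← hd'] at s1
  obtain ⟨f, hf⟩ : ∃ f, t = d + f := ⟨t - d, by omega⟩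
  have e2 : t - d = f := by omega
  rw [e2] at rule
  rw [hf] at rule
  nlinarith

end Irr

end

section
open Finset
open scoped Classical

variable {V : Type} {G : SimpleGraph V} {col : V → Bool} {t : ℕ} {c : ℤ → V}

/-- If the predecessors of two vertices at even places of a closed path have many neighbours, the
two vertices are joined by a long path. -/
lemma exists_cross (bip : ∀ u v, G.Adj u v → col u ≠ col v) {D : List V} {y x : V}
    (h : IsP G D y x) (hxy : G.Adj x y) {j m δ : ℕ} (hlen : D.length = 2 * j) (hm : m % 2 = 0)
    (hm2 : 2 ≤ m) (hmj : m + 2 ≤ 2 * j) (h1 : δ ≤ #(nidx G D x))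
    (h2 : δ ≤ #(nidx G D (D[m - 1]'(by omega)))) :
    ∃ Q, IsP G Q y (D[m]'(by omega)) ∧ (∀ v ∈ Q, v ∈ D) ∧ 2 * δ - 1 ≤ Q.length := by
  have hm1 : m - 1 < D.length := by omega
  have hm0 : m < D.length := by omega
  have hδ : δ ≤ j := by
    have := card_even_nidx_le bip h (bip _ _ hxy)
    omega
  have ev1 : ∀ s ∈ nidx G D x, s % 2 = 0 := fun s hs => nidx_even bip h (bip _ _ hxy) hs
  have ev2 : ∀ s ∈ nidx G D D[m - 1], s % 2 = 0 := fun s hs => nidx_even bip h (by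
    rw [col_getElem bip h]
    have : (m - 1) % 2 = 1 := by omega
    simp [this]) hs
  by_cases c1 : ∃ s, s + 4 ≤ m ∧ s ∈ nidx G D D[m - 1] ∧ s + 2 ∈ nidx G D x
  · obtain ⟨s, hs, hs2, hs1⟩ := c1
    obtain ⟨q2, e2⟩ := mem_nidx.1 hs2
    obtain ⟨q1, e1⟩ := mem_nidx.1 hs1
    have p1 := h.take q2
    have p2 := ((h.drop q1).take (i := m - s - 3) (by simp; omega)).reverse
    have p3 := (h.drop hm0).reverse
    have ee : (D.drop (s + 2))[m - s - 3]'(by simp; omega) = D[m - 1] := by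
      rw [List.getElem_drop]; congr 1; omega
    rw [ee] at p2
    have p12 := p1.append p2 e2.symm (by
      intro v hv hv'
      rw [List.mem_reverse] at hv'
      exact h.mem_take_drop (by omega) hv (List.mem_of_mem_take hv'))
    have p := p12.append p3 e1.symm (by
      intro v hv hv'
      rw [List.mem_reverse] at hv'
      rw [List.mem_append, List.mem_reverse] at hv
      rcases hv with hv | hv
      · exact h.mem_take_drop (by omega) hv hv'
      · rw [List.take_drop] at hv
        exact h.mem_take_drop (by omega) (List.mem_of_mem_drop hv) hv')
    refine ⟨_, p, ?_, by simp; omega⟩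
    intro v hv
    simp only [List.mem_append, List.mem_reverse] at hv
    rcases hv with (hv | hv) | hv
    · exact List.mem_of_mem_take hv
    · exact List.mem_of_mem_drop (List.mem_of_mem_take hv)
    · exact List.mem_of_mem_drop hv
  by_cases c2 : ∃ s, m ≤ s ∧ s ∈ nidx G D x ∧ s + 2 ∈ nidx G D D[m - 1]
  · obtain ⟨s, hs, hs1, hs2⟩ := c2
    obtain ⟨q2, e2⟩ := mem_nidx.1 hs2
    obtain ⟨q1, e1⟩ := mem_nidx.1 hs1
    have p1 := (h.drop hm0).take (i := s - m) (by simp; omega)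
    have ee : (D.drop m)[s - m]'(by simp; omega) = D[s] := by
      rw [List.getElem_drop]; congr 1; omega
    rw [ee] at p1
    have p2 := (h.drop q2).reverse
    have p3 := (h.take hm1).reverse
    have p12 := p1.append p2 e1.symm (by
      intro v hv hv'
      rw [List.mem_reverse] at hv'
      rw [List.take_drop] at hv
      exact h.mem_take_drop (by omega) (List.mem_of_mem_drop hv) hv')
    have p := p12.append p3 e2.symm (by
      intro v hv hv'
      rw [List.mem_reverse] at hv'
      rw [List.mem_append, List.mem_reverse] at hv
      rcases hv with hv | hv
      · exact h.mem_take_drop (by omega) hv' (List.mem_of_mem_take hv)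
      · exact h.mem_take_drop (by omega) hv' hv)
    refine ⟨_, p.reverse, ?_, by simp; omega⟩
    intro v hv
    simp only [List.mem_append, List.mem_reverse] at hv
    rcases hv with (hv | hv) | hv
    · exact List.mem_of_mem_drop (List.mem_of_mem_take hv)
    · exact List.mem_of_mem_drop hv
    · exact List.mem_of_mem_take hv
  push Not at c1 c2
  set B1 := (nidx G D x).image fun s => if s < m then s / 2 else s / 2 + 2
  set B2 := (nidx G D D[m - 1]).image fun s => s / 2 + 1
  have k1 : #B1 = #(nidx G D x) := by
    refine card_image_of_injOn fun s hs s' hs' e => ?_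
    have := ev1 s hs
    have := ev1 s' hs'
    split_ifs at e <;> omega
  have k2 : #B2 = #(nidx G D D[m - 1]) := by
    refine card_image_of_injOn fun s hs s' hs' e => ?_
    have := ev2 s hs
    have := ev2 s' hs'
    omega
  have hd : Disjoint B1 B2 := by
    rw [disjoint_left]
    intro r hr1 hr2
    obtain ⟨s, hs, rfl⟩ := mem_image.1 hr1
    obtain ⟨s', hs', e⟩ := mem_image.1 hr2
    have e1 := ev1 s hs
    have e2 := ev2 s' hs'
    split_ifs at e with hsm
    · have : s = s' + 2 := by omega
      subst this
      exact c1 s' (by omega) hs' hs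
    · have : s' = s + 2 := by omega
      subst this
      exact c2 s (by omega) hs hs'
  have hsub : B1 ∪ B2 ⊆ range (j + 2) := by
    intro r hr
    rw [mem_range]
    rcases mem_union.1 hr with hr | hr
    · obtain ⟨s, hs, rfl⟩ := mem_image.1 hr
      obtain ⟨q, -⟩ := mem_nidx.1 hs
      split_ifs <;> omega
    · obtain ⟨s, hs, rfl⟩ := mem_image.1 hr
      obtain ⟨q, -⟩ := mem_nidx.1 hs
      omega
  have hc := card_le_card hsub
  rw [card_union_of_disjoint hd, k1, k2, card_range] at hc
  obtain ⟨Q, hQ, hQl, hQD⟩ := exists_arc h hxy (k := j) hlen.ge h.head_mem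
    (List.getElem_mem hm0) (fun e => by
      have := h.getElem_inj h.length_pos hm0 (h.head_eq.trans e)
      omega)
  exact ⟨Q, hQ, hQD, by omega⟩

end

section
open Finset
open scoped Classical

variable {V : Type} {G : SimpleGraph V} {col : V → Bool} {t : ℕ} {c : ℤ → V}
variable [Fintype V]

namespace Irr
variable {w : Bool → ℕ} {U : Finset V} (H : LC G col t c) (I : Irr G col t c w U)
include H I

lemma closed_not_pair {s : Bool} {δ : ℕ} (M : Mode G col t c w U s δ) {Z : List V} {a v : V}
    (h : PU G U Z a v) (hva : G.Adj v a) {j : ℕ} (hlen : Z.length = 2 * j) (hs : col a = s)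
    {i₁ i₂ : ℕ} (h12 : i₁ < i₂) (e1 : i₁ % 2 = 0) (e2 : i₂ % 2 = 0) (hi1 : i₁ + 1 < Z.length)
    (hi : i₂ + 1 < Z.length)
    (n1 : ∀ z ∈ U, G.Adj Z[i₁] z → z ∈ Z) (n2 : ∀ z ∈ U, G.Adj Z[i₂] z → z ∈ Z)
    (d1 : dC G c Z[i₁] = 0) (d2 : dC G c Z[i₂] = 0) {p q : ℤ} (hp : G.Adj Z[i₁ + 1] (c p))
    (hq : G.Adj Z[i₂ + 1] (c q)) (hpq : c p ≠ c q) : False := by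
  have hx (i : ℕ) (hi : i < Z.length) : col Z[i] = (col a).xor (decide (i % 2 = 1)) :=
    col_getElem H.bip h.1 i hi
  have hx1 : col Z[i₁] = s := by rw [hx, hs]; simp [e1]
  have hx2 : col Z[i₂] = s := by rw [hx, hs]; simp [e2]
  have hy1 : col Z[i₁ + 1] = !s := by
    rw [hx, hs]
    have : (i₁ + 1) % 2 = 1 := by omega
    simp [this]
  have hy2 : col Z[i₂ + 1] = !s := by
    rw [hx, hs]
    have : (i₂ + 1) % 2 = 1 := by omega
    simp [this]
  have hD := h.1.shift hva hi1
  set D := Z.drop (i₁ + 1) ++ Z.take (i₁ + 1) with hDdef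
  have hDl : D.length = 2 * j := by rw [← hlen, length_shift]
  have hDm : ∀ z, z ∈ D ↔ z ∈ Z := fun z => mem_shift
  have hDU : ∀ z ∈ D, z ∈ U := fun z hz => h.2 z ((hDm z).1 hz)
  have g1 : D[i₂ - i₁ - 1]'(by omega) = Z[i₂] := by
    simp only [hDdef]
    rw [List.getElem_append_left (by simp; omega), List.getElem_drop]
    congr 1; omega
  have g2 : D[i₂ - i₁]'(by omega) = Z[i₂ + 1] := by
    simp only [hDdef]
    rw [List.getElem_append_left (by simp; omega), List.getElem_drop]
    congr 1; omega
  have c1 : dU G U Z[i₁] = #(nidx G D Z[i₁]) :=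
    card_nidx hD.nodup hDU fun x hx hax => (hDm x).2 (n1 x hx hax)
  have c2 : dU G U Z[i₂] = #(nidx G D Z[i₂]) :=
    card_nidx hD.nodup hDU fun x hx hax => (hDm x).2 (n2 x hx hax)
  have b1 := M.deg _ (h.2 _ (List.getElem_mem _)) hx1
  have b2 := M.deg _ (h.2 _ (List.getElem_mem _)) hx2
  have hδj : δ ≤ j := by
    have := card_even_nidx_le H.bip hD (x := Z[i₁]) (by rw [hx1, hy1]; cases s <;> simp)
    omega
  obtain ⟨Q, hQ, hQD, hQl⟩ := exists_cross H.bip hD (h.1.adj hi1) hDl (m := i₂ - i₁) (δ := δ)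
    (by omega) (by omega) (by omega) (by omega) (by rw [g1]; omega)
  rw [g2] at hQ
  have hQo : ∀ z ∈ Q, Out c z := fun z hz => I.out z (hDU z (hQD z hz))
  have conn : Conn G c Z[i₁ + 1] Z[i₂ + 1] (2 * δ - 1) := ⟨Q, hQ, hQo, hQl⟩
  have g := H.gap_two conn hp hq hpq
  have := M.pos
  rcases M.mode with m | ⟨m, -⟩ | ⟨y, hy, hys, hy2', hyt⟩
  · omega
  · omega
  · have hys' : col y = !s := Bool.eq_not_of_ne hys
    by_cases hyQ : y ∈ Q
    · obtain ⟨z, hz, hyz, hzs, hz1⟩ : ∃ z ∈ D, y ≠ z ∧ col z = !s ∧ 1 ≤ dC G c z := by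
        by_cases hc : y = Z[i₁ + 1]
        · refine ⟨Z[i₂ + 1], by rw [hDm]; exact List.getElem_mem _, ?_, hy2, H.dC_pos hq⟩
          rw [hc]
          intro e
          have := h.1.getElem_inj _ _ e
          omega
        · exact ⟨Z[i₁ + 1], by rw [hDm]; exact List.getElem_mem _, hc, hy1, H.dC_pos hp⟩
      obtain ⟨l', hl', hn, hlD⟩ := exists_arc hD (h.1.adj hi1) (k := j) hDl.ge (hQD y hyQ) hz hyz
      have := H.gap_one_side' (n := j + 1) ⟨l', hl', fun v hv => I.out v (hDU v (hlD v hv)), hn⟩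
        (by omega) (by rw [hys', hzs]) hz1
      omega
    · have := H.gap_cross_same hQ hQo hQl M.pos hy hyQ (by rw [hy1, hy2]) (by rw [hy1, hys'])
        hp hq hpq
      omega

lemma false_of_free {s : Bool} {δ : ℕ} (M : Mode G col t c w U s δ) {l₀ : List V} {a₀ b : V}
    (h₀ : Longest G U l₀ a₀ b) (hs : col b = s)
    (hfree : ∀ l a, Longest G U l a b → dC G c a = 0) : False := by
  have hcol : ∀ l a, Longest G U l a b → col a = s := fun l a h => by
    obtain ⟨-, -, -, e, -⟩ := I.odd_length_form H h
    rw [e, hs]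
  let P : ℕ → Prop := fun J => ∃ l a, Longest G U l a b ∧ J ∈ nidx G l a
  have hPU : ∀ J, P J → J ≤ #U := by
    rintro J ⟨l, a, h, hJ⟩
    obtain ⟨hJ, -⟩ := mem_nidx.1 hJ
    have := h.1.length_le
    omega
  obtain ⟨J₀, hJ₀⟩ : ∃ J, P J := by
    have := I.one_le_dU (h₀.1.2 _ h₀.1.1.head_mem)
    rw [h₀.card_nidx] at this
    obtain ⟨J, hJ⟩ := card_pos.1 this
    exact ⟨J, _, _, h₀, hJ⟩
  set J := Nat.findGreatest P #U with hJdef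
  have hPJ : P J := Nat.findGreatest_spec (hPU _ hJ₀) hJ₀
  have hmax : ∀ l a, Longest G U l a b → ∀ i ∈ nidx G l a, i ≤ J := fun l a h i hi =>
    Nat.le_findGreatest (hPU _ ⟨l, a, h, hi⟩) ⟨l, a, h, hi⟩
  obtain ⟨l, a, h, hJ⟩ := hPJ
  have hJo := nidx_odd H.bip h.1.1 rfl hJ
  obtain ⟨hJl, haJ⟩ := mem_nidx.1 hJ
  have hlo := I.odd_length_of_longest H h
  have hJl' : J + 1 < l.length := by omega
  clear_value J
  set v := l[J] with hv
  have hZ := h.1.1.take hJl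
  set Z := l.take (J + 1) with hZdef
  have hZl : Z.length = J + 1 := by simp [hZdef]; omega
  have hZU : ∀ z ∈ Z, z ∈ U := fun z hz => h.1.2 z (List.mem_of_mem_take hz)
  have ext : ∀ D x, IsP G D x v → (∀ y, y ∈ D ↔ y ∈ Z) →
      dC G c x = 0 ∧ (∀ z ∈ U, G.Adj x z → z ∈ D) ∧ col x = s := by
    intro D x hD hDZ
    have hDl : D.length = J + 1 := by
      rw [← hZl, ← List.toFinset_card_of_nodup hD.nodup, ← List.toFinset_card_of_nodup hZ.nodup]
      congr 1
      ext y
      simp [hDZ]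
    have hL : Longest G U (D ++ l.drop (J + 1)) x b := by
      refine h.of_le ⟨hD.append (h.1.1.drop hJl') (h.1.1.adj hJl') ?_, ?_⟩ ?_
      · intro y hy
        exact h.1.1.mem_take_drop le_rfl ((hDZ y).1 hy)
      · intro y hy
        rcases List.mem_append.1 hy with hy | hy
        · exact hZU y ((hDZ y).1 hy)
        · exact h.1.2 y (List.mem_of_mem_drop hy)
      · simp; omega
    refine ⟨hfree _ _ hL, fun z hz hxz => ?_, hcol _ _ hL⟩
    obtain ⟨i, hi, rfl⟩ := List.getElem_of_mem (hL.mem_of_adj hz hxz)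
    have := hmax _ _ hL i (mem_nidx.2 ⟨hi, hxz⟩)
    rw [List.getElem_append_left (by omega)]
    exact List.getElem_mem _
  obtain ⟨x₀, hx₀, hxmax⟩ := exists_max_image
    ({x : V | ∃ D, IsP G D x v ∧ ∀ y, y ∈ D ↔ y ∈ Z} : Finset V) (dU G U)
    ⟨a, by simpa using ⟨Z, hZ, fun _ => Iff.rfl⟩⟩
  simp only [mem_filter, mem_univ, true_and] at hx₀ hxmax
  obtain ⟨D₀, hD₀, hD₀Z⟩ := hx₀
  obtain ⟨f1, f2, f3⟩ := ext _ _ hD₀ hD₀Z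
  have hD₀U : ∀ z ∈ D₀, z ∈ U := fun z hz => hZU z ((hD₀Z z).1 hz)
  have hd : dU G U x₀ = #(nidx G D₀ x₀) := card_nidx hD₀.nodup hD₀U f2
  set d := dU G U x₀ with hddef
  have hd1 : 1 ≤ d := I.one_le_dU (hD₀U _ hD₀.head_mem)
  obtain ⟨r1, r2, r3⟩ := pred_set H.bip ⟨hD₀, hD₀U⟩ (S := nidx G D₀ x₀) subset_rfl
  set R := at' D₀ x₀ ((nidx G D₀ x₀).image (· - 1)) with hR
  have hRE : ∀ z ∈ R, ∃ D, IsP G D z v ∧ ∀ y, y ∈ D ↔ y ∈ Z := by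
    intro z hz
    obtain ⟨i, hi, hi', rfl⟩ := r3 z hz
    exact ⟨_, hD₀.rotate hi (mem_nidx.1 hi').2, fun y => mem_rotate.trans (hD₀Z y)⟩
  set K : Finset ℕ := {i ∈ range (J + 1) | ∃ h : i < Z.length, Z[i] ∈ R} with hK
  have hKm : ∀ {i}, i ∈ K ↔ ∃ h : i < Z.length, Z[i] ∈ R := by
    intro i
    simp only [hK, mem_filter, mem_range, and_iff_right_iff_imp]
    rintro ⟨h, -⟩
    omega
  have has : col a = s := hcol _ _ h
  have hKe : ∀ i ∈ K, i % 2 = 0 ∧ i + 1 < Z.length := by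
    intro i hi
    obtain ⟨hi, hi'⟩ := hKm.1 hi
    have h1 := (mem_part.1 (r1 hi')).2
    rw [col_getElem H.bip hZ, has, f3] at h1
    have : i % 2 = 0 := by
      by_contra hc
      have : i % 2 = 1 := by omega
      simp [this] at h1
    exact ⟨this, by omega⟩
  have hKR : at' Z a K = R := by
    ext z
    rw [mem_at' fun i hi => (hKm.1 hi).1]
    constructor
    · rintro ⟨i, hi, hi', rfl⟩
      exact (hKm.1 hi').2
    · intro hz
      obtain ⟨D, hD, hDZ⟩ := hRE z hz
      obtain ⟨i, hi, e⟩ := List.getElem_of_mem ((hDZ z).1 hD.head_mem)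
      exact ⟨i, hi, hKm.2 ⟨hi, e ▸ hz⟩, e⟩
  have hKc : #K = d := by
    rw [hd, ← r2, ← hKR, card_at' hZ.nodup fun i hi => (hKm.1 hi).1]
  have hY' : ∀ i ∈ K.image (· + 1), i < Z.length := by
    intro i hi
    obtain ⟨i', hi', rfl⟩ := mem_image.1 hi
    exact (hKe i' hi').2
  set Y := at' Z a (K.image (· + 1)) with hY
  have hYc : #Y = d := by
    rw [hY, card_at' hZ.nodup hY', card_image_of_injective _ (add_left_injective 1), hKc]
  have hYm : ∀ y ∈ Y, ∃ i ∈ K, ∃ h : i + 1 < Z.length, y = Z[i + 1] := by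
    intro y hy
    obtain ⟨i, hi, hi', rfl⟩ := (mem_at' hY').1 hy
    obtain ⟨i', hi'', rfl⟩ := mem_image.1 hi'
    exact ⟨i', hi'', hi, rfl⟩
  have hYp : Y ⊆ part col U (!(col x₀)) := by
    intro y hy
    obtain ⟨i, hi, hi', rfl⟩ := hYm y hy
    rw [mem_part, col_getElem H.bip hZ, has, f3]
    have := hKe i hi
    refine ⟨hZU _ (List.getElem_mem _), ?_⟩
    have : (i + 1) % 2 = 1 := by omega
    simp [this]
  have hRc : #R = d := r2.trans hd.symm
  have s1 : ∑ x ∈ R, (dU G U x + dC G c x) ≤ #R • d := by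
    refine sum_le_card_nsmul _ _ _ fun x hx => ?_
    obtain ⟨D, hD, hDZ⟩ := hRE x hx
    have := hxmax x ⟨D, hD, hDZ⟩
    have := (ext D x hD hDZ).1
    omega
  rw [hRc, smul_eq_mul] at s1
  have hRne : R.Nonempty := card_pos.1 (by omega)
  have hdt : d ≤ t := by
    rw [← hRc]
    exact (card_le_card r1).trans (I.card _)
  obtain ⟨f, rfl⟩ : ∃ f, t = d + f := ⟨t - d, by omega⟩
  have hw := I.sum (col x₀)
  have hw2 := I.two_le (col x₀)
  obtain ⟨y1, hy1, hy1d⟩ : ∃ y ∈ Y, 2 ≤ dC G c y := by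
    by_contra hc
    push Not at hc
    have s2 : ∑ y ∈ Y, dC G c y ≤ #Y • 1 :=
      sum_le_card_nsmul _ _ _ fun y hy => by have := hc y hy; omega
    have rule := I.rule' H.bip r1 hYp (hRne.mono subset_union_left)
    rw [hRc, hYc, ← add_mul, hw, Nat.add_sub_cancel_left] at rule
    rw [hYc, smul_eq_mul] at s2
    nlinarith
  obtain ⟨y2, hy2, hy2d⟩ : ∃ y ∈ Y.erase y1, 1 ≤ dC G c y := by
    by_contra hc
    push Not at hc
    have s2 : ∑ y ∈ Y.erase y1, dC G c y = 0 :=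
      sum_eq_zero fun y hy => by have := hc y hy; omega
    have rule := I.rule' H.bip r1 ((erase_subset y1 Y).trans hYp) (hRne.mono subset_union_left)
    rw [hRc, card_erase_of_mem hy1, hYc, s2, Nat.add_sub_cancel_left] at rule
    obtain ⟨e, he⟩ : ∃ e, d = e + 1 := ⟨d - 1, by omega⟩
    rw [he] at s1 rule hw
    rw [Nat.add_sub_cancel] at rule
    generalize ∑ x ∈ R, (dU G U x + dC G c x) = S at *
    have e1 : w (col x₀) * (e + 1) + w (!col x₀) * e =
      (w (col x₀) + w (!col x₀)) * e + w (col x₀) := by ring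
    rw [e1, hw] at rule
    nlinarith
  obtain ⟨i1, hi1, hi1', rfl⟩ := hYm y1 hy1
  obtain ⟨i2, hi2, hi2', rfl⟩ := hYm y2 (mem_of_mem_erase hy2)
  have hne : i1 ≠ i2 := by
    rintro rfl
    simp at hy2
  obtain ⟨q, hq⟩ := H.exists_adj hy2d
  obtain ⟨p, hp, hpq⟩ := H.exists_adj_ne (x := c q) hy1d
  have nb : ∀ i ∈ K, ∀ hi : i < Z.length, dC G c Z[i] = 0 ∧ ∀ z ∈ U, G.Adj Z[i] z → z ∈ Z := by
    intro i hi hil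
    obtain ⟨D, hD, hDZ⟩ := hRE _ (hKm.1 hi).2
    obtain ⟨g1, g2, -⟩ := ext _ _ hD hDZ
    exact ⟨g1, fun z hz hz' => (hDZ z).1 (g2 z hz hz')⟩
  have hZj : Z.length = 2 * ((J + 1) / 2) := by omega
  have n1 := nb _ hi1 (by omega)
  have n2 := nb _ hi2 (by omega)
  rcases lt_or_gt_of_ne hne with hlt | hlt
  · exact I.closed_not_pair H M ⟨hZ, hZU⟩ haJ.symm hZj has hlt (hKe _ hi1).1 (hKe _ hi2).1 hi1' hi2'
      n1.2 n2.2 n1.1 n2.1 hp hq hpq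
  · exact I.closed_not_pair H M ⟨hZ, hZU⟩ haJ.symm hZj has hlt (hKe _ hi2).1 (hKe _ hi1).1 hi2' hi1'
      n2.2 n1.2 n2.1 n1.1 hq hp hpq.symm

theorem false (hU : U.Nonempty) (M : ∀ s, ∃ δ, Mode G col t c w U s δ) : False := by
  obtain ⟨l, a, b, h, hfree⟩ : ∃ l a b, Longest G U l a b ∧
      ∀ l a, Longest G U l a b → dC G c a = 0 := by
    by_cases hc : ∃ l a b, Longest G U l a b ∧ 1 ≤ dC G c b
    · obtain ⟨l, a, b, h, hb⟩ := hc
      refine ⟨l, a, b, h, fun l' a' h' => ?_⟩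
      by_contra ha
      obtain ⟨δ, M⟩ := M (col a')
      exact I.odd_not_both H M h' rfl (by omega) hb
    · push Not at hc
      obtain ⟨l, a, b, h⟩ := exists_longest (G := G) hU
      exact ⟨l, a, b, h, fun l' a' h' => by have := hc _ _ _ h'.reverse; omega⟩
  obtain ⟨δ, M⟩ := M (col b)
  exact I.false_of_free H M h rfl hfree

end Irr

end

section
open Finset
open scoped Classical

variable {V : Type} {G : SimpleGraph V} {col : V → Bool} {t : ℕ} {c : ℤ → V}
variable [Fintype V]

namespace LC
variable (H : LC G col t c)
include H

lemma F2_le_of_modes {w : Bool → ℕ} (hw : ∀ s, w s + w (!s) = 2 * t + 2) (hw2 : ∀ s, 2 ≤ w s)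
    (hd : ∀ v, Out c v → 2 * dC G c v ≤ w (col v))
    (hM : ∀ U, Irr G col t c w U → ∀ s, ∃ δ, Mode G col t c w U s δ) :
    ∀ U : Finset V, (∀ v ∈ U, Out c v) → (∀ s, #(part col U s) ≤ t) →
      F2 G c U ≤ ∑ v ∈ U, w (col v) := by
  intro U
  induction U using Finset.strongInduction with
  | H U ih =>
    intro ho ht
    by_contra hc
    have I : Irr G col t c w U := by
      refine ⟨ho, ht, hw, hw2, fun v hv => hd v (ho v hv), fun W hW hne => ?_⟩
      have := ih (U \ W) (sdiff_ssubset hW hne) (fun v hv => ho v (mem_sdiff.1 hv).1) fun s =>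
        (card_le_card (filter_subset_filter _ sdiff_subset)).trans (ht s)
      have := sum_sdiff (f := fun v => w (col v)) hW
      omega
    refine I.false H ?_ (hM U I)
    rw [nonempty_iff_ne_empty]
    rintro rfl
    simp [F2] at hc

lemma exists_weight : ∃ w : Bool → ℕ, (∀ s, w s + w (!s) = 2 * t + 2) ∧ (∀ s, 2 ≤ w s) ∧
    ∀ U : Finset V, (∀ v ∈ U, Out c v) → (∀ s, #(part col U s) ≤ t) →
      F2 G c U ≤ ∑ v ∈ U, w (col v) := by
  have ht := H.two_le
  by_cases hc : ∀ v, Out c v → 2 * dC G c v ≤ t + 1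
  · refine ⟨fun _ => t + 1, fun s => by dsimp only; omega, fun s => by dsimp only; omega,
      H.F2_le_of_modes (w := fun _ => t + 1) (fun s => by omega) (fun s => by omega) hc fun U I s =>
        ⟨(t + 3) / 2, ⟨fun x hx _ => ?_, by omega, Or.inr (Or.inl ⟨by omega, rfl⟩)⟩⟩⟩
    have := I.deg hx
    omega
  · push Not at hc
    obtain ⟨v, hv, hv2⟩ := hc
    obtain ⟨y, hy, hmax⟩ := exists_max_image ({v : V | Out c v} : Finset V) (dC G c)
      ⟨v, by simpa using hv⟩
    simp only [mem_filter, mem_univ, true_and] at hy hmax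
    have h1 := hmax v hv
    have h2 := H.dC_le y
    set w : Bool → ℕ := fun s => if s = col y then 2 * dC G c y else 2 * (t + 1 - dC G c y) with hw
    have w1 : ∀ s, s = col y → w s = 2 * dC G c y := fun s hs => by simp [hw, hs]
    have w2 : ∀ s, s ≠ col y → w s = 2 * (t + 1 - dC G c y) := fun s hs => by simp [hw, hs]
    have hws : ∀ s, w s + w (!s) = 2 * t + 2 := by
      intro s
      by_cases hs : s = col y
      · rw [w1 s hs, w2 (!s) (by rw [hs]; simp)]; omega
      · rw [w2 s hs, w1 (!s) (by revert hs; cases s <;> cases col y <;> simp)]; omega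
    have hw2 : ∀ s, 2 ≤ w s := by
      intro s
      by_cases hs : s = col y
      · rw [w1 s hs]; omega
      · rw [w2 s hs]; omega
    refine ⟨w, hws, hw2, H.F2_le_of_modes hws hw2 (fun x hx => ?_) fun U I s => ?_⟩
    · by_cases hs : col x = col y
      · rw [w1 _ hs]
        have := hmax x hx
        omega
      · rw [w2 _ hs]
        have := H.dC_add_le hy hx hs
        omega
    · by_cases hs : s = col y
      · refine ⟨dC G c y + 1, fun x hx hxs => ?_, by omega, Or.inl (by omega)⟩
        have := I.deg hx
        rw [hxs, w1 s hs] at this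
        omega
      · refine ⟨t + 2 - dC G c y, fun x hx hxs => ?_, by omega,
          Or.inr (Or.inr ⟨y, hy, fun e => hs e.symm, by omega, by omega⟩)⟩
        have := I.deg hx
        rw [hxs, w2 s hs] at this
        omega

end LC

end

section
open Finset
open scoped Classical

variable {V : Type} {G : SimpleGraph V} {col : V → Bool} {t : ℕ} {c : ℤ → V}

/-- A closed path extends along a walk of length two leaving it. -/
lemma exists_extend (bip : ∀ u v, G.Adj u v → col u ≠ col v) {D : List V} {p q x y z : V}
    (h : IsP G D p q) (hqp : G.Adj q p) (hx : x ∈ D) (hxy : G.Adj x y) (hyz : G.Adj y z)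
    (hz : z ∉ D) :
    ∃ l e, IsP G l z e ∧ col e = col z ∧ D.length + 1 ≤ l.length ∧
      ∀ v ∈ l, v ∈ D ∨ v = y ∨ v = z := by
  have b1 := bip _ _ hxy
  have b2 := bip _ _ hyz
  by_cases hy : y ∈ D
  · obtain ⟨D', e, h1, h2, h3, h4⟩ := exists_shift h hqp hy
    refine ⟨[z] ++ D', e, (IsP.singleton z).append h1 hyz.symm ?_, ?_, by simp [h3], ?_⟩
    · intro v hv hv'
      rw [List.mem_singleton] at hv
      subst hv
      exact hz ((h4 v).1 hv')
    · have := bip _ _ h2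
      revert this b2
      cases col e <;> cases col y <;> cases col z <;> simp
    · intro v hv
      rcases List.mem_append.1 hv with hv | hv
      · rw [List.mem_singleton] at hv
        exact Or.inr (Or.inr hv)
      · exact Or.inl ((h4 v).1 hv)
  · obtain ⟨D', e, h1, h2, h3, h4⟩ := exists_shift h hqp hx
    have hpar : ¬ D'.length % 2 = 1 := fun hc => bip _ _ h2 ((odd_length bip h1).1 hc).symm
    have hpos := h1.length_pos
    have hl : D'.length - 2 < D'.length := by omega
    have h5 := h1.take hl
    refine ⟨[z] ++ ([y] ++ D'.take (D'.length - 2 + 1)), D'[D'.length - 2],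
      (IsP.singleton z).append ((IsP.singleton y).append h5 hxy.symm ?_) hyz.symm ?_, ?_, ?_, ?_⟩
    · intro v hv hv'
      rw [List.mem_singleton] at hv
      subst hv
      exact hy ((h4 v).1 (List.mem_of_mem_take hv'))
    · intro v hv hv'
      rw [List.mem_singleton] at hv
      subst hv
      rcases List.mem_append.1 hv' with hv' | hv'
      · rw [List.mem_singleton] at hv'
        exact hyz.ne hv'.symm
      · exact hz ((h4 v).1 (List.mem_of_mem_take hv'))
    · rw [col_getElem bip h1]
      have : ¬ (D'.length - 2) % 2 = 1 := by omega
      simp only [this, decide_false, Bool.xor_false]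
      revert b1 b2
      cases col x <;> cases col y <;> cases col z <;> simp
    · simp; omega
    · intro v hv
      rcases List.mem_append.1 hv with hv | hv
      · rw [List.mem_singleton] at hv
        exact Or.inr (Or.inr hv)
      rcases List.mem_append.1 hv with hv | hv
      · rw [List.mem_singleton] at hv
        exact Or.inr (Or.inl hv)
      · exact Or.inl ((h4 v).1 (List.mem_of_mem_take hv))

lemma col_of_adj (bip : ∀ u v, G.Adj u v → col u ≠ col v) {x y : V} {s : Bool} (h : G.Adj x y)
    (hx : col x = s) : col y = !s := by
  have := bip _ _ h
  rw [hx] at this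
  exact Bool.eq_not_of_ne this.symm

/-- The neighbours inside `U` of the vertices of `S`. -/
noncomputable def nb (G : SimpleGraph V) (U S : Finset V) : Finset V := {y ∈ U | ∃ x ∈ S, G.Adj x y}

lemma mem_nb {U S : Finset V} {y : V} : y ∈ nb G U S ↔ y ∈ U ∧ ∃ x ∈ S, G.Adj x y := by
  simp [nb]

variable [Fintype V]

namespace LC
variable (H : LC G col t c)
include H

lemma exists_deg_le {U : Finset V} {s : Bool} (ho : ∀ v ∈ U, Out c v)
    (hlt : #(part col U (!s)) < #(part col U s)) (ht : #(part col U (!s)) ≤ t) :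
    ∃ x ∈ part col U s, dU G U x + dC G c x ≤ t := by
  by_contra hdeg
  push Not at hdeg
  have ht2 := H.two_le
  obtain ⟨A, hA, hmin⟩ := exists_min_image
    ({A ∈ (part col U s).powerset | #(nb G U A) < #A} : Finset (Finset V)) card
    ⟨part col U s, by
      rw [mem_filter, mem_powerset]
      refine ⟨subset_rfl, (card_le_card fun y hy => ?_).trans_lt hlt⟩
      obtain ⟨hy, x, hx, hxy⟩ := mem_nb.1 hy
      exact mem_part.2 ⟨hy, col_of_adj H.bip hxy (mem_part.1 hx).2⟩⟩
  rw [mem_filter, mem_powerset] at hA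
  obtain ⟨hAU, hA⟩ := hA
  have hAs : ∀ x ∈ A, x ∈ U ∧ col x = s := fun x hx => mem_part.1 (hAU hx)
  have hall : ∀ S ⊂ A, #S ≤ #(nb G U S) := by
    intro S hS
    by_contra hc
    have := hmin S (by
      rw [mem_filter, mem_powerset]
      exact ⟨hS.1.trans hAU, by omega⟩)
    have := card_lt_card hS
    omega
  have hNs : ∀ y ∈ nb G U A, y ∈ U ∧ col y = !s := fun y hy => by
    obtain ⟨hy, x, hx, hxy⟩ := mem_nb.1 hy
    exact ⟨hy, col_of_adj H.bip hxy (hAs x hx).2⟩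
  obtain ⟨x₀, hx₀⟩ : A.Nonempty := card_pos.1 (by omega)
  set W := A ∪ nb G U A with hW
  have hWU : ∀ v ∈ W, v ∈ U := by
    intro v hv
    rcases mem_union.1 hv with hv | hv
    · exact (hAs v hv).1
    · exact (hNs v hv).1
  have hWA : ∀ v ∈ W, col v = s → v ∈ A := by
    intro v hv hs
    rcases mem_union.1 hv with hv | hv
    · exact hv
    · have := (hNs v hv).2
      rw [hs] at this
      cases s <;> simp at this
  obtain ⟨l, a, e, h, ha, he, hmaxl⟩ : ∃ l a e, PU G W l a e ∧ a ∈ A ∧ e ∈ A ∧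
      ∀ l' a' e', PU G W l' a' e' → a' ∈ A → e' ∈ A → l'.length ≤ l.length := by
    let P : ℕ → Prop := fun n => ∃ l a e, PU G W l a e ∧ a ∈ A ∧ e ∈ A ∧ l.length = n
    have h1 : P 1 := ⟨[x₀], x₀, x₀, ⟨IsP.singleton x₀, by simpa [hW] using Or.inl hx₀⟩, hx₀, hx₀, rfl⟩
    have hb : ∀ n, P n → n ≤ #W := by
      rintro n ⟨l, a, e, h, -, -, rfl⟩; exact h.length_le
    obtain ⟨l, a, e, h, ha, he, hl⟩ := Nat.findGreatest_spec (P := P) (hb 1 h1) h1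
    refine ⟨l, a, e, h, ha, he, fun l' a' e' h' ha' he' => ?_⟩
    rw [hl]
    exact Nat.le_findGreatest h'.length_le ⟨l', a', e', h', ha', he', rfl⟩
  obtain ⟨haU, has⟩ := hAs a ha
  obtain ⟨heU, hes⟩ := hAs e he
  have hodd := (odd_length H.bip h.1).2 (has.trans hes.symm)
  obtain ⟨k, hk⟩ : ∃ k, l.length + 1 = 2 * k := ⟨(l.length + 1) / 2, by omega⟩
  obtain ⟨cX, cY⟩ := card_part_list H.bip h.1
  rw [has] at cX cY
  have hlo : ∀ v ∈ l, Out c v := fun v hv => ho v (hWU v (h.2 v hv))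
  have hlA : part col l.toFinset s ⊆ A := by
    intro v hv
    obtain ⟨hv, hs⟩ := mem_part.1 hv
    exact hWA v (h.2 v (by simpa using hv)) hs
  have hlB : part col l.toFinset (!s) ⊆ nb G U A := by
    intro v hv
    obtain ⟨hv, hs⟩ := mem_part.1 hv
    rcases mem_union.1 (h.2 v (by simpa using hv)) with hv | hv
    · have := (hAs v hv).2
      rw [hs] at this
      cases s <;> simp at this
    · exact hv
  have hNB : nb G U A ⊆ part col U (!s) := fun y hy => mem_part.2 (hNs y hy)
  have cB := card_le_card hlB
  have cB' := card_le_card hNB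
  have hda := hdeg a (mem_part.2 ⟨haU, has⟩)
  have hde := hdeg e (mem_part.2 ⟨heU, hes⟩)
  have hNbr : ∀ x ∈ A, {y ∈ U | G.Adj x y} ⊆ nb G U A := by
    intro x hx y hy
    rw [mem_filter] at hy
    exact mem_nb.2 ⟨hy.1, x, hx, hy.2⟩
  -- no closed path on `2 * k` vertices contains all the `A`-vertices of `l`
  have notClosed : ∀ D p q, IsP G D p q → G.Adj q p → D.length = 2 * k → (∀ v ∈ l, v ∈ D) →
      (∀ v ∈ D, v ∈ W) → False := by
    intro D p q hD hqp hDl hlD hDW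
    obtain ⟨f1, f2⟩ := card_part_list H.bip hD
    have hDs : ∀ s', #(part col D.toFinset s') = k := by
      intro s'
      by_cases hs' : s' = col p
      · rw [hs', f1]; omega
      · rw [Bool.eq_not_of_ne hs', f2]; omega
    have hDA : ∀ v ∈ D, col v = s → v ∈ l := by
      intro v hv hvs
      have hsub : part col l.toFinset s ⊆ part col D.toFinset s :=
        filter_subset_filter _ fun v hv => by
          rw [List.mem_toFinset] at hv ⊢; exact hlD v hv
      have := eq_of_subset_of_card_le hsub (by rw [hDs, cX]; omega)
      have hv' : v ∈ part col D.toFinset s := mem_part.2 ⟨List.mem_toFinset.2 hv, hvs⟩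
      rw [← this] at hv'
      exact List.mem_toFinset.1 (mem_part.1 hv').1
    have clos : ∀ x ∈ part col l.toFinset s, ∀ y ∈ U, G.Adj x y → ∀ z ∈ A, G.Adj y z →
        z ∈ part col l.toFinset s := by
      intro x hx y hy hxy z hz hyz
      obtain ⟨hx, hxs⟩ := mem_part.1 hx
      rw [List.mem_toFinset] at hx
      by_contra hzl
      have hzD : z ∉ D := fun hc =>
        hzl (mem_part.2 ⟨List.mem_toFinset.2 (hDA z hc (hAs z hz).2), (hAs z hz).2⟩)
      obtain ⟨l', e', h1, h2, h3, h4⟩ := exists_extend H.bip hD hqp (hlD x hx) hxy hyz hzD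
      have hPW : PU G W l' z e' := by
        refine ⟨h1, fun v hv => ?_⟩
        rcases h4 v hv with hv | rfl | rfl
        · exact hDW v hv
        · exact mem_union_right _ (mem_nb.2 ⟨hy, z, hz, hyz.symm⟩)
        · exact mem_union_left _ hz
      have := hmaxl _ _ _ hPW hz (hWA _ (hPW.2 _ h1.last_mem) (h2.trans (hAs z hz).2))
      omega
    have hDN : part col D.toFinset (!s) ⊆ nb G U A := by
      intro v hv
      obtain ⟨hv, hs⟩ := mem_part.1 hv
      rcases mem_union.1 (hDW v (by simpa using hv)) with hv | hv
      · have := (hAs v hv).2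
        rw [hs] at this
        cases s <;> simp at this
      · exact hv
    have hDN' := card_le_card hDN
    rw [hDs] at hDN'
    have hss : part col l.toFinset s ⊂ A := by
      refine hlA.ssubset_of_ne fun hc => ?_
      rw [hc] at cX
      omega
    have hss' : A \ part col l.toFinset s ⊂ A := by
      refine sdiff_ssubset hlA ?_
      exact ⟨a, mem_part.2 ⟨List.mem_toFinset.2 h.1.head_mem, has⟩⟩
    have g1 := hall _ hss
    have g2 := hall _ hss'
    have hdisj : Disjoint (nb G U (part col l.toFinset s)) (nb G U (A \ part col l.toFinset s)) := by
      rw [disjoint_left]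
      intro y hy hy'
      obtain ⟨hy, x, hx, hxy⟩ := mem_nb.1 hy
      obtain ⟨-, z, hz, hzy⟩ := mem_nb.1 hy'
      rw [mem_sdiff] at hz
      exact hz.2 (clos x hx y hy hxy z hz.1 hzy.symm)
    have hsub : nb G U (part col l.toFinset s) ∪ nb G U (A \ part col l.toFinset s) ⊆ nb G U A := by
      intro y hy
      rcases mem_union.1 hy with hy | hy
      · obtain ⟨hy, x, hx, hxy⟩ := mem_nb.1 hy
        exact mem_nb.2 ⟨hy, x, hlA hx, hxy⟩
      · obtain ⟨hy, x, hx, hxy⟩ := mem_nb.1 hy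
        exact mem_nb.2 ⟨hy, x, (mem_sdiff.1 hx).1, hxy⟩
    have g3 := card_le_card hsub
    rw [card_union_of_disjoint hdisj] at g3
    have g4 := card_sdiff_add_card_eq_card hlA
    omega
  have dUa : dU G U a ≤ t := (dU_le_part H.bip (s := !s) (by simpa using has)).trans ht
  have dUe : dU G U e ≤ t := (dU_le_part H.bip (s := !s) (by simpa using hes)).trans ht
  by_cases hsh : ∃ y ∈ U, y ∉ l ∧ G.Adj a y ∧ G.Adj e y
  · obtain ⟨y, hy, hyl, hay, hey⟩ := hsh
    refine notClosed (l ++ [y]) a y (h.1.append (IsP.singleton y) hey ?_) hay.symm (by simp; omega)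
      (fun v hv => by simp [hv]) ?_
    · intro v hv hv'
      rw [List.mem_singleton] at hv'
      subst hv'
      exact hyl hv
    · intro v hv
      rcases List.mem_append.1 hv with hv | hv
      · exact h.2 v hv
      · rw [List.mem_singleton] at hv
        subst hv
        exact mem_union_right _ (mem_nb.2 ⟨hy, a, ha, hay⟩)
  push Not at hsh
  have hk2 : 2 ≤ k := by
    by_contra hc
    have hl1 : l.length = 1 := by have := h.1.length_pos; omega
    have hae := h.1.eq_of_length_one hl1
    have hc := H.dC_le a
    obtain ⟨y, hy, hay⟩ := dU_pos.1 (by omega : 1 ≤ dU G U a)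
    refine hsh y hy ?_ hay (hae ▸ hay)
    intro hyl
    obtain ⟨i, hi, rfl⟩ := List.getElem_of_mem hyl
    have : i = 0 := by omega
    subst this
    rw [h.1.head_eq] at hay
    exact hay.ne rfl
  have hsum : dU G U a + dU G U e + 1 ≤ #(part col U (!s)) + k := by
    have h1 := card_union_add_card_inter {y ∈ U | G.Adj a y} {y ∈ U | G.Adj e y}
    have h2 : {y ∈ U | G.Adj a y} ∪ {y ∈ U | G.Adj e y} ⊆ part col U (!s) :=
      union_subset ((hNbr a ha).trans hNB) ((hNbr e he).trans hNB)
    have h3 : {y ∈ U | G.Adj a y} ∩ {y ∈ U | G.Adj e y} ⊆ part col l.toFinset (!s) := by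
      intro y hy
      rw [mem_inter, mem_filter, mem_filter] at hy
      refine mem_part.2 ⟨?_, col_of_adj H.bip hy.1.2 has⟩
      rw [List.mem_toFinset]
      by_contra hyl
      exact hsh y hy.1.1 hyl hy.1.2 hy.2.2
    have h2' := card_le_card h2
    have h3' := card_le_card h3
    unfold dU
    omega
  have conn : Conn G c a e (2 * k - 1) := ⟨l, h.1, hlo, by omega⟩
  obtain ⟨i, hi⟩ := H.exists_adj (by omega : 1 ≤ dC G c a)
  obtain ⟨j, hj⟩ := H.exists_adj (by omega : 1 ≤ dC G c e)
  by_cases hg : ∃ i j, G.Adj a (c i) ∧ G.Adj e (c j) ∧ c i ≠ c j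
  · obtain ⟨i, j, hi, hj, hij⟩ := hg
    have := H.gap_same conn hk2 (has.trans hes.symm) hi hj hij.symm
    omega
  · push Not at hg
    have ca : dC G c a ≤ 1 := by
      by_contra hc
      obtain ⟨i', hi', hne⟩ := H.exists_adj_ne (x := c j) (by omega : 2 ≤ dC G c a)
      exact hne (hg _ _ hi' hj)
    have ce : dC G c e ≤ 1 := by
      by_contra hc
      obtain ⟨i', hi', hne⟩ := H.exists_adj_ne (x := c i) (by omega : 2 ≤ dC G c e)
      exact hne (hg _ _ hi hi').symm
    have := H.cyc0 h.1 hlo hi (hg _ _ hi hj ▸ hj) (by omega)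
    omega

end LC

end

section
open Finset
open scoped Classical

variable {V : Type} {G : SimpleGraph V} {col : V → Bool} {t : ℕ} {c : ℤ → V}
variable [Fintype V]

omit [Fintype V] in
lemma sum_part (U : Finset V) (w : Bool → ℕ) (s : Bool) :
    ∑ v ∈ U, w (col v) = w s * #(part col U s) + w (!s) * #(part col U (!s)) := by
  have h : part col U (!s) = {v ∈ U | ¬ col v = s} := by
    ext v
    simp only [mem_part, mem_filter]
    cases col v <;> cases s <;> simp
  rw [← sum_filter_add_sum_filter_not U (fun v => col v = s), h, part]
  congr 1
  · rw [sum_congr rfl (g := fun _ => w s) fun v hv => by rw [(mem_filter.1 hv).2], sum_const,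
      smul_eq_mul, mul_comm]
  · rw [sum_congr rfl (g := fun _ => w !s) fun v hv => by
      rw [Bool.eq_not_of_ne (mem_filter.1 hv).2], sum_const, smul_eq_mul, mul_comm]

omit [Fintype V] in
lemma part_erase (U : Finset V) (x : V) (s : Bool) :
    part col (U.erase x) s = (part col U s).erase x := by
  ext v
  simp only [mem_part, mem_erase]
  tauto

namespace LC
variable (H : LC G col t c)
include H

theorem F2_le {s : Bool} : ∀ U : Finset V, (∀ v ∈ U, Out c v) →
    #(part col U (!s)) ≤ #(part col U s) → #(part col U (!s)) ≤ t →
    F2 G c U ≤ 2 * t * #(part col U s) + 2 * #(part col U (!s)) := by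
  intro U
  induction U using Finset.strongInduction with
  | H U ih =>
    intro ho hle ht
    by_cases hst : #(part col U s) ≤ t
    · obtain ⟨w, w1, w2, h⟩ := H.exists_weight
      have h := h U ho fun s' => by
        by_cases hs : s' = s
        · rwa [hs]
        · rwa [Bool.eq_not_of_ne hs]
      rw [sum_part U w s] at h
      obtain ⟨d, hd⟩ := Nat.exists_eq_add_of_le hle
      obtain ⟨r, hr⟩ := Nat.exists_eq_add_of_le (w2 (!s))
      have := w1 s
      rw [hd] at h ⊢
      generalize #(part col U (!s)) = b at *
      have e : w s + r = 2 * t := by omega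
      rw [hr] at h
      rw [← e]
      nlinarith [Nat.zero_le (r * d)]
    · obtain ⟨x, hx, hdx⟩ := H.exists_deg_le ho (by omega : #(part col U (!s)) < #(part col U s)) ht
      obtain ⟨hxU, hxs⟩ := mem_part.1 hx
      have hx' : x ∉ part col U (!s) := fun h => by
        have := (mem_part.1 h).2
        rw [hxs] at this
        cases s <;> simp at this
      have := ih (U.erase x) (erase_ssubset hxU) (fun v hv => ho v (mem_of_mem_erase hv))
      rw [part_erase, part_erase, erase_eq_of_notMem hx', card_erase_of_mem hx] at this
      have := this (by omega) ht
      rw [F2_erase hxU]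
      obtain ⟨n, hn⟩ : ∃ n, #(part col U s) = n + 1 := ⟨#(part col U s) - 1, by omega⟩
      rw [hn, Nat.add_sub_cancel] at this
      rw [hn]
      have e : 2 * t * (n + 1) = 2 * t * n + 2 * t := by ring
      omega

lemma card_cycle_part (s : Bool) : #({v | ¬ Out c v ∧ col v = s} : Finset V) = t := by
  obtain ⟨j, rfl⟩ : ∃ j, col (c j) = s := by
    by_cases h : col (c 0) = s
    · exact ⟨0, h⟩
    · refine ⟨0 + 1, ?_⟩
      have := H.col_c_ne 0
      revert this h
      cases col (c 0) <;> cases col (c (0 + 1)) <;> cases s <;> simp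
  have : ({v | ¬ Out c v ∧ col v = col (c j)} : Finset V) =
      (range t).image fun p : ℕ => c (j + 2 * p) := by
    ext v
    simp only [mem_filter, mem_univ, true_and, mem_image, mem_range]
    constructor
    · rintro ⟨hv, hc⟩
      simp only [Out, not_forall, not_not] at hv
      obtain ⟨i, rfl⟩ := hv
      obtain ⟨p, hp, e⟩ := H.exists_idx hc
      exact ⟨p, hp, e.symm⟩
    · rintro ⟨p, -, rfl⟩
      exact ⟨fun h => h _ rfl, H.col_c j p⟩
  rw [this, card_image_of_injOn, card_range]
  intro p hp q hq e
  have hp : p < t := by simpa using hp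
  have hq : q < t := by simpa using hq
  dsimp only at e
  rcases le_total p q with h | h
  · have := H.inj' e (by omega) (by omega)
    omega
  · have := H.inj' e.symm (by omega) (by omega)
    omega

omit H in
lemma two_mul_ncard_edges :
    2 * {e ∈ G.edgeSet | ∃ x, x ∈ e ∧ Out c x}.ncard = F2 G c ({v | Out c v} : Finset V) := by
  let G' : SimpleGraph V :=
    { Adj := fun u v => G.Adj u v ∧ (Out c u ∨ Out c v)
      symm := ⟨fun u v h => ⟨h.1.symm, h.2.symm⟩⟩
      loopless := ⟨fun u h => h.1.ne rfl⟩ }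
  have hE : {e ∈ G.edgeSet | ∃ x, x ∈ e ∧ Out c x} = G'.edgeSet := by
    ext e
    induction e using Sym2.ind with
    | h u v =>
      simp only [Set.mem_ofPred_eq, SimpleGraph.mem_edgeSet, Sym2.mem_iff, G']
      constructor
      · rintro ⟨h, x, rfl | rfl, hx⟩
        · exact ⟨h, Or.inl hx⟩
        · exact ⟨h, Or.inr hx⟩
      · rintro ⟨h, hx | hx⟩
        · exact ⟨h, _, Or.inl rfl, hx⟩
        · exact ⟨h, _, Or.inr rfl, hx⟩
  rw [hE, ← SimpleGraph.coe_edgeFinset, Set.ncard_coe_finset,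
    ← G'.sum_degrees_eq_twice_card_edges]
  set U : Finset V := {v | Out c v} with hU
  have hUm : ∀ v, v ∈ U ↔ Out c v := fun v => by simp [hU]
  have d1 : ∀ v ∈ U, G'.degree v = dU G U v + dC G c v := by
    intro v hv
    rw [← SimpleGraph.card_neighborFinset_eq_degree, dU, dC, ← card_union_of_disjoint]
    · congr 1
      ext x
      have := (hUm v).1 hv
      simp only [SimpleGraph.mem_neighborFinset, mem_union, mem_filter, mem_univ, true_and, hUm, G']
      tauto
    · rw [disjoint_left]
      intro x hx hx'
      simp only [mem_filter, mem_univ, true_and, hUm] at hx hx'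
      exact hx'.2 hx.1
  have d2 : ∀ v ∈ Uᶜ, G'.degree v = #{x ∈ U | G.Adj v x} := by
    intro v hv
    rw [← SimpleGraph.card_neighborFinset_eq_degree]
    congr 1
    ext x
    rw [mem_compl, hUm] at hv
    simp only [SimpleGraph.mem_neighborFinset, mem_filter, hUm, G']
    tauto
  have d3 : ∑ v ∈ Uᶜ, #{x ∈ U | G.Adj v x} = ∑ v ∈ U, dC G c v := by
    simp only [card_filter]
    rw [sum_comm]
    refine sum_congr rfl fun v _ => ?_
    rw [← card_filter, dC]
    congr 1
    ext x
    simp only [mem_filter, mem_compl, mem_univ, true_and, hUm, G.adj_comm]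
    tauto
  rw [← sum_add_sum_compl U, sum_congr rfl d1, sum_congr rfl d2, d3, ← sum_add_distrib, F2]
  exact sum_congr rfl fun v _ => by ring

end LC

/-- The vertices of a closed walk of length `n`, enumerated cyclically. -/
def cyc {v₀ : V} (C : G.Walk v₀ v₀) (i : ℤ) : V := C.getVert (i % C.length).toNat

omit [Fintype V] in
lemma cyc_natCast {v₀ : V} (C : G.Walk v₀ v₀) {n : ℕ} (hn : n ≤ C.length) :
    cyc C n = C.getVert n := by
  rcases hn.lt_or_eq with h | rfl
  · rw [cyc, Int.emod_eq_of_lt (by omega) (by omega)]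
    simp
  · simp [cyc]

omit [Fintype V] in
lemma out_cyc {v₀ : V} (C : G.Walk v₀ v₀) (h0 : 0 < C.length) {v : V} :
    Out (cyc C) v ↔ v ∉ C.support := by
  rw [← not_iff_not, not_not, SimpleGraph.Walk.mem_support_iff_exists_getVert]
  simp only [Out, not_forall, not_not]
  constructor
  · rintro ⟨i, rfl⟩
    have := Int.emod_lt_of_pos i (by omega : (0:ℤ) < C.length)
    exact ⟨_, rfl, by omega⟩
  · rintro ⟨n, rfl, hn⟩
    exact ⟨n, (cyc_natCast C hn).symm⟩

omit [Fintype V] in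
lemma lc_cyc (bip : ∀ u v, G.Adj u v → col u ≠ col v) {v₀ : V} {C : G.Walk v₀ v₀}
    (hC : C.IsCycle) (hlong : ∀ (u : V) (w : G.Walk u u), w.IsCycle → w.length ≤ C.length)
    (hlen : C.length = 2 * t) : LC G col t (cyc C) where
  two_le := by
    have := hC.three_le_length
    omega
  bip := bip
  adj i := by
    have h3 := hC.three_le_length
    have h1 := Int.emod_lt_of_pos i (by omega : (0:ℤ) < C.length)
    have h2 := Int.emod_nonneg i (by omega : (C.length : ℤ) ≠ 0)
    have h := C.adj_getVert_succ (i := (i % C.length).toNat) (by omega)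
    have e : cyc C (i + 1) = cyc C (((i % C.length).toNat + 1 : ℕ) : ℤ) := by
      unfold cyc
      push_cast
      rw [Int.toNat_of_nonneg h2, Int.emod_add_emod]
    rw [e, cyc_natCast C (by omega)]
    exact h
  per i := by
    have : (2 * t : ℤ) = C.length := by omega
    simp [cyc, this]
  inj i j h := by
    have h3 := hC.three_le_length
    have h1 := Int.emod_lt_of_pos i (by omega : (0:ℤ) < C.length)
    have h2 := Int.emod_nonneg i (by omega : (C.length : ℤ) ≠ 0)
    have h1' := Int.emod_lt_of_pos j (by omega : (0:ℤ) < C.length)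
    have h2' := Int.emod_nonneg j (by omega : (C.length : ℤ) ≠ 0)
    have := hC.getVert_injOn' (by simp only [Set.mem_ofPred_eq]; omega)
      (by simp only [Set.mem_ofPred_eq]; omega) h
    have e : (2 * t : ℤ) = C.length := by omega
    rw [e]
    exact Int.dvd_of_emod_eq_zero (Int.emod_eq_emod_iff_emod_sub_eq_zero.1 (by omega))
  long l a b h hl hba := by
    obtain ⟨hch, hnd, hhd, hla⟩ := h
    have hne : l ≠ [] := by
      rintro rfl
      simp at hl
    have ha : l.head hne = a := by
      rw [List.head?_eq_some_head hne] at hhd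
      exact Option.some.inj hhd
    have hb : l.getLast hne = b := by
      rw [List.getLast?_eq_some_getLast hne] at hla
      exact Option.some.inj hla
    rw [← ha, ← hb] at hba
    let p := SimpleGraph.Walk.ofSupport l hne hch
    have hp : p.IsPath := by
      rw [SimpleGraph.Walk.isPath_def, SimpleGraph.Walk.support_ofSupport]
      exact hnd
    have hpl : p.length = l.length - 1 := SimpleGraph.Walk.length_ofSupport _ _
    have hc : (SimpleGraph.Walk.cons hba p).IsCycle := by
      rw [SimpleGraph.Walk.cons_isCycle_iff]
      refine ⟨hp, fun he => ?_⟩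
      rw [Sym2.eq_swap] at he
      have := hp.length_eq_one_of_mem_edges he
      omega
    have := hlong _ _ hc
    rw [SimpleGraph.Walk.length_cons] at this
    omega

end

end BipCycle

theorem stmt_6 {V : Type} [Fintype V] [DecidableEq V]
    (G : SimpleGraph V) (X Y : Finset V) (n m t : ℕ)
    (hpart : ∀ v : V, v ∈ X ∨ v ∈ Y) (hdisj : Disjoint X Y)
    (hbip : ∀ u v : V, G.Adj u v → (u ∈ X ∧ v ∈ Y) ∨ (u ∈ Y ∧ v ∈ X))
    (hX : X.card = n) (hY : Y.card = m)
    (v₀ : V) (C : G.Walk v₀ v₀) (hC : C.IsCycle)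
    (hlongest : ∀ (u : V) (w : G.Walk u u), w.IsCycle → w.length ≤ C.length)
    (hlen : C.length = 2 * t)
    (hmn : m ≤ n) (htm : t ≤ m) (hm2t : m ≤ 2 * t) :
    ({e ∈ G.edgeSet | ∃ x, x ∈ e ∧ x ∉ C.support}.ncard : ℤ) ≤
      (t : ℤ) * ((n : ℤ) - 1 - (t : ℤ)) + (m : ℤ) := by
  classical
  have hXY : ∀ v, v ∈ Y ↔ v ∉ X := fun v =>
    ⟨fun h h' => Finset.disjoint_left.1 hdisj h' h, fun h => (hpart v).resolve_left h⟩
  let col : V → Bool := fun v => decide (v ∈ X)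
  have H : BipCycle.LC G col t (BipCycle.cyc C) := by
    refine BipCycle.lc_cyc (fun u v h => ?_) hC hlongest hlen
    rcases hbip u v h with ⟨h1, h2⟩ | ⟨h1, h2⟩
    · simp [col, h1, (hXY v).1 h2]
    · simp [col, h2, (hXY u).1 h1]
  have h0 : 0 < C.length := by have := H.two_le; omega
  have hcard : ∀ s, (BipCycle.part col {v | BipCycle.Out (BipCycle.cyc C) v} s).card + t =
      ({v | col v = s} : Finset V).card := by
    intro s
    rw [← H.card_cycle_part s, ← Finset.card_union_of_disjoint]
    · congr 1
      ext v
      simp only [Finset.mem_union, BipCycle.mem_part, Finset.mem_filter, Finset.mem_univ, true_and]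
      tauto
    · rw [Finset.disjoint_left]
      intro v hv hv'
      simp only [BipCycle.mem_part, Finset.mem_filter, Finset.mem_univ, true_and] at hv hv'
      exact hv'.1 hv.1
  have hcX := hcard true
  have hcY := hcard false
  have eX : ({v | col v = true} : Finset V) = X := by ext v; simp [col]
  have eY : ({v | col v = false} : Finset V) = Y := by ext v; simp [col, hXY]
  rw [eX, hX] at hcX
  rw [eY, hY] at hcY
  have hF := H.F2_le (s := true) {v | BipCycle.Out (BipCycle.cyc C) v} (by simp)
    (by simp only [Bool.not_true]; omega) (by simp only [Bool.not_true]; omega)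
  rw [← BipCycle.LC.two_mul_ncard_edges, Bool.not_true] at hF
  simp only [BipCycle.out_cyc C h0] at hF hcX hcY
  generalize (BipCycle.part col {v | v ∉ C.support} true).card = a at *
  generalize (BipCycle.part col {v | v ∉ C.support} false).card = b at *
  subst hcX hcY
  zify at hF ⊢
  nlinarith
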